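/- arXiv:1608.04588 — 2 statements merged into one kernel-verified Lean document; each statement's English description precedes it below -/
import Mathlib

section
/- Let R be a Gorenstein local ring and let M and N be finitely generated R-modules, where N has reducible complexity (for instance, N has finite complete intersection dimension). Then Ext^i_R(M,N) = 0 for all i ≫ 0 if and only if Ext^i_R(N,M) = 0 for all i ≫ 0. -/
open CategoryTheory CategoryTheory.Limits CategoryTheory.MonoidalCategory Opposite

noncomputable section

universe u

variable (R : Type u) [CommRing R]

/-- Ordinary `Ext` of `R`-modules, via the derived functor `Ext` of Mathlib. -/
abbrev ExtMod (n : ℕ) (M N : ModuleCat.{u} R) : ModuleCat.{u} R :=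
  ((Ext R (ModuleCat.{u} R) n).obj (op M)).obj N

/-- Ordinary `Tor` of `R`-modules, via the derived functor `Tor` of Mathlib. -/
abbrev TorMod (n : ℕ) (M N : ModuleCat.{u} R) : ModuleCat.{u} R :=
  ((Tor (ModuleCat.{u} R) n).obj M).obj N

/-- A finitely generated module `M` is totally reflexive (of G-dimension zero) if the
biduality map is an isomorphism and `Ext^i(M,R) = 0 = Ext^i(M^*,R)` for all `i > 0`. -/
def IsTotallyReflexive (M : ModuleCat.{u} R) : Prop :=
  Module.Finite R M ∧
  Function.Bijective (Module.Dual.eval R M) ∧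
  (∀ i : ℕ, 0 < i → IsZero (ExtMod R i M (ModuleCat.of R R))) ∧
  (∀ i : ℕ, 0 < i → IsZero (ExtMod R i (ModuleCat.of R (Module.Dual R M)) (ModuleCat.of R R)))

/-- `M` admits a resolution `0 → G_n → ⋯ → G_0 → M → 0` by totally reflexive modules. -/
def GDimLE (M : ModuleCat.{u} R) (n : ℕ) : Prop :=
  ∃ (G : ChainComplex (ModuleCat.{u} R) ℕ) (ε : G.X 0 ⟶ M),
    (∀ i, i ≤ n → IsTotallyReflexive R (G.X i)) ∧
    (∀ i, n < i → IsZero (G.X i)) ∧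
    Epi ε ∧
    (∃ w : G.d 1 0 ≫ ε = 0, (ShortComplex.mk (G.d 1 0) ε w).Exact) ∧
    (∀ i, 0 < i → G.ExactAt i)

/-- `M` has finite Gorenstein dimension. -/
def HasFiniteGDim (M : ModuleCat.{u} R) : Prop := ∃ n, GDimLE R M n

/-- The Gorenstein dimension of `M`, as an element of `ℕ∞`. -/
def gdim (M : ModuleCat.{u} R) : ℕ∞ :=
  sInf {c : ℕ∞ | ∃ n : ℕ, c = n ∧ GDimLE R M n}

/-- `M` admits a projective resolution of length at most `n`. -/
def PdLE (M : ModuleCat.{u} R) (n : ℕ) : Prop :=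
  ∃ (G : ChainComplex (ModuleCat.{u} R) ℕ) (ε : G.X 0 ⟶ M),
    (∀ i, Projective (G.X i)) ∧
    (∀ i, n < i → IsZero (G.X i)) ∧
    Epi ε ∧
    (∃ w : G.d 1 0 ≫ ε = 0, (ShortComplex.mk (G.d 1 0) ε w).Exact) ∧
    (∀ i, 0 < i → G.ExactAt i)

/-- `M` has finite projective dimension. -/
def HasFinitePd (M : ModuleCat.{u} R) : Prop := ∃ n, PdLE R M n

/-- The projective dimension of `M`, as an element of `ℕ∞`. -/
def pdim (M : ModuleCat.{u} R) : ℕ∞ :=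
  sInf {c : ℕ∞ | ∃ n : ℕ, c = n ∧ PdLE R M n}

/-- `M` admits an injective resolution `0 → M → I^0 → ⋯ → I^n → 0`. -/
def InjDimLE (M : ModuleCat.{u} R) (n : ℕ) : Prop :=
  ∃ (I : CochainComplex (ModuleCat.{u} R) ℕ) (ι : M ⟶ I.X 0),
    (∀ i, Injective (I.X i)) ∧
    (∀ i, n < i → IsZero (I.X i)) ∧
    Mono ι ∧
    (∃ w : ι ≫ I.d 0 1 = 0, (ShortComplex.mk ι (I.d 0 1) w).Exact) ∧
    (∀ i, 0 < i → I.ExactAt i)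

/-- `M` has finite injective dimension. -/
def HasFiniteInjDim (M : ModuleCat.{u} R) : Prop := ∃ n, InjDimLE R M n

/-- A Gorenstein local ring: a commutative Noetherian local ring of finite self-injective
dimension. -/
def IsGorensteinLocalRing : Prop :=
  IsLocalRing R ∧ IsNoetherianRing R ∧ HasFiniteInjDim R (ModuleCat.of R R)

/-- The grade of a module: `grade M = inf { i | Ext^i(M,R) ≠ 0 }`. -/
def gradeM (M : ModuleCat.{u} R) : ℕ∞ :=
  sInf {c : ℕ∞ | ∃ i : ℕ, c = i ∧ ¬ IsZero (ExtMod R i M (ModuleCat.of R R))}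

/-- A module is G-perfect if its grade equals its Gorenstein dimension. -/
def IsGPerfect (M : ModuleCat.{u} R) : Prop := gradeM R M = gdim R M

/-- An ideal `c` is perfect if `grade (R/c) = pd (R/c)`. -/
def IsPerfectIdeal (c : Ideal R) : Prop :=
  gradeM R (ModuleCat.of R (R ⧸ c)) = pdim R (ModuleCat.of R (R ⧸ c))

/-- A complete resolution `T → P → M` of `M`: `P → M` is a resolution by finite projective
modules, `T` is a totally acyclic complex of finite projective modules, and `θ i` is an
isomorphism for all `i ≫ 0`. -/
structure CompleteResolution (M : ModuleCat.{u} R) where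
  T : ChainComplex (ModuleCat.{u} R) ℤ
  P : ChainComplex (ModuleCat.{u} R) ℤ
  θ : T ⟶ P
  π : P.X 0 ⟶ M
  projT : ∀ i, Projective (T.X i)
  fgT : ∀ i, Module.Finite R (T.X i)
  projP : ∀ i, Projective (P.X i)
  fgP : ∀ i, Module.Finite R (P.X i)
  zeroP : ∀ i : ℤ, i < 0 → IsZero (P.X i)
  epiπ : Epi π
  wπ : P.d 1 0 ≫ π = 0
  exact0 : (ShortComplex.mk (P.d 1 0) π wπ).Exact
  exactP : ∀ i : ℤ, 0 < i → P.ExactAt i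
  exactT : ∀ i : ℤ, T.ExactAt i
  exactTdual : ∀ i : ℤ, (T.linearYonedaObj R (ModuleCat.of R R)).ExactAt i
  iso_eventually : ∃ n₀ : ℤ, ∀ i : ℤ, n₀ ≤ i → IsIso (θ.f i)

/-- Tate cohomology `Êxt^i(M,N) = H^i(Hom(T,N))` computed from a complete resolution of `M`. -/
def TateExt {M : ModuleCat.{u} R} (C : CompleteResolution R M) (N : ModuleCat.{u} R)
    (i : ℤ) : ModuleCat.{u} R :=
  (C.T.linearYonedaObj R N).homology i

/-- Tate homology `T̂or_i(M,N) = H_i(T ⊗ N)` computed from a complete resolution of `M`. -/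
def TateTor {M : ModuleCat.{u} R} (C : CompleteResolution R M) (N : ModuleCat.{u} R)
    (i : ℤ) : ModuleCat.{u} R :=
  ((((tensoringRight (ModuleCat.{u} R)).obj N).mapHomologicalComplex _).obj C.T).homology i

/-- The depth of a module over a local ring: the supremum of the lengths of the
`M`-regular sequences contained in the maximal ideal. -/
def moduleDepth [IsLocalRing R] (M : Type u) [AddCommGroup M] [Module R M] : ℕ∞ :=
  sSup {c : ℕ∞ | ∃ rs : List R, c = rs.length ∧
    (∀ r ∈ rs, r ∈ IsLocalRing.maximalIdeal R) ∧ RingTheory.Sequence.IsRegular M rs}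

/-- `E` is an injective envelope of the residue field `k`: an injective module which is an
essential extension of `k`. -/
def IsInjectiveEnvelopeOfResidueField [IsLocalRing R] (E : Type u) [AddCommGroup E]
    [Module R E] : Prop :=
  Injective (ModuleCat.of R E) ∧
  ∃ ι : IsLocalRing.ResidueField R →ₗ[R] E,
    Function.Injective ι ∧
    ∀ N : Submodule R E, N ≠ ⊥ → N ⊓ LinearMap.range ι ≠ ⊥


/-- A minimal free resolution `⋯ → F_1 → F_0 → M → 0` of a finitely generated module over a
local ring, recorded by its Betti numbers `b n` and differentials with image inside
`m • F_n`. -/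
structure MinFreeRes [IsLocalRing R] (M : Type u) [AddCommGroup M] [Module R M] where
  b : ℕ → ℕ
  d : ∀ n : ℕ, ((Fin (b (n+1)) → R) →ₗ[R] (Fin (b n) → R))
  aug : (Fin (b 0) → R) →ₗ[R] M
  aug_surj : Function.Surjective aug
  exact_zero : LinearMap.ker aug = LinearMap.range (d 0)
  exact_succ : ∀ n, LinearMap.ker (d n) = LinearMap.range (d (n+1))
  minimal : ∀ n, LinearMap.range (d n) ≤ (IsLocalRing.maximalIdeal R) • ⊤

/-- The Betti numbers of `M` are eventually bounded by `γ · n^(c-1)`. -/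
def CxLE [IsLocalRing R] (M : Type u) [AddCommGroup M] [Module R M] (c : ℕ) : Prop :=
  ∃ (F : MinFreeRes R M) (γ : ℝ) (n₀ : ℕ),
    ∀ n : ℕ, n₀ ≤ n → (F.b n : ℝ) ≤ γ * (n : ℝ) ^ ((c : ℤ) - 1)

/-- The complexity of a module: the least `c` such that the Betti numbers are eventually
bounded by `γ · n^(c-1)` for some `γ`. -/
def complexity [IsLocalRing R] (M : Type u) [AddCommGroup M] [Module R M] : ℕ∞ :=
  sInf {e : ℕ∞ | ∃ c : ℕ, e = c ∧ CxLE R M c}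

/-- The pushout `K_η` of a map `f : Ω^{j+1} M → M` (representing a degree-`(j+1)`
homogeneous element `η` of `Ext^*(M,M)`) along the inclusion `Ω^{j+1} M ↪ F_j`: the
cokernel of `(f, -incl) : Ω^{j+1} M → M ⊕ F_j`. -/
abbrev PushoutMod [IsLocalRing R] {M : Type u} [AddCommGroup M] [Module R M]
    (F : MinFreeRes R M) (j : ℕ) (f : LinearMap.range (F.d j) →ₗ[R] M) : Type u :=
  (M × (Fin (F.b j) → R)) ⧸
    LinearMap.range (LinearMap.prod f (-(LinearMap.range (F.d j)).subtype))

/-- Auxiliary predicate: `M` has reducible complexity, with recursion depth `≤ c`. -/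
def RedCxAux [IsLocalRing R] :
    ℕ → ∀ (M : Type u) (_ : AddCommGroup M) (_ : Module R M), Prop
  | 0, M, g, m =>
      letI := g; letI := m
      HasFinitePd R (ModuleCat.of R M)
  | (c+1), M, g, m =>
      letI := g; letI := m
      HasFinitePd R (ModuleCat.of R M) ∨
      (complexity R M < ⊤ ∧ 0 < complexity R M ∧
        ∃ (j : ℕ) (F : MinFreeRes R M) (f : LinearMap.range (F.d j) →ₗ[R] M),
          complexity R (PushoutMod R F j f) < complexity R M ∧
          moduleDepth R (PushoutMod R F j f) = moduleDepth R M ∧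
          RedCxAux c (PushoutMod R F j f) inferInstance inferInstance)

/-- `M` has reducible complexity. -/
def HasReducibleComplexity [IsLocalRing R] (M : Type u) [AddCommGroup M] [Module R M] :
    Prop :=
  ∃ c : ℕ, RedCxAux R c M inferInstance inferInstance

/-- `L` is (isomorphic to) `λ N = Ω Tr N`, computed from a minimal free presentation of `N`
over the local ring `S`. -/
def IsLambdaOf (S : Type u) [CommRing S] [IsLocalRing S]
    (N L : Type u) [AddCommGroup N] [Module S N] [AddCommGroup L] [Module S L] : Prop :=
  ∃ (n₀ n₁ : ℕ) (g : (Fin n₀ → S) →ₗ[S] N) (f : (Fin n₁ → S) →ₗ[S] (Fin n₀ → S)),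
    Function.Surjective g ∧
    LinearMap.range f = LinearMap.ker g ∧
    LinearMap.ker g ≤ (IsLocalRing.maximalIdeal S) • ⊤ ∧
    LinearMap.ker f ≤ (IsLocalRing.maximalIdeal S) • ⊤ ∧
    Nonempty (L ≃ₗ[S] LinearMap.range f.dualMap)

/-- `M` and `N` are linked by the ideal `c`: both are annihilated by `c` (hence are
`R/c`-modules) and `M ≅ λ_{R/c} N`, `N ≅ λ_{R/c} M`. -/
def LinkedBy (c : Ideal R) (M N : Type u) [AddCommGroup M] [Module (R ⧸ c) M]
    [AddCommGroup N] [Module (R ⧸ c) N] [IsLocalRing (R ⧸ c)] : Prop :=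
  IsLambdaOf (R ⧸ c) N M ∧ IsLambdaOf (R ⧸ c) M N


/-! ### Vanishing of Ext, unbundled -/

namespace RC

variable {R : Type} [CommRing R]

/-- `Ext^i(A,B) = 0`, stated with the derived-category `Ext`. -/
def EZ (R : Type) [CommRing R] (i : ℕ) (A B : Type) [AddCommGroup A] [Module R A]
    [AddCommGroup B] [Module R B] : Prop :=
  Subsingleton (Abelian.Ext.{0} (ModuleCat.of R A) (ModuleCat.of R B) i)

lemma isZero_iff (i : ℕ) (A B : ModuleCat.{0} R) :
    IsZero (ExtMod R (i+1) A B) ↔ Subsingleton (Abelian.Ext.{0} A B (i+1)) := by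
  let P : ProjectiveResolution A := ProjectiveResolution.of A
  rw [(P.isoExt (R := R) (i+1) B).isZero_iff, ← HomologicalComplex.exactAt_iff_isZero_homology,
    HomologicalComplex.exactAt_iff' _ i (i+1) (i+2) (by simp) (by simp),
    ShortComplex.moduleCat_exact_iff]
  constructor
  · intro h
    refine ⟨fun a b => ?_⟩
    have key : ∀ a : Abelian.Ext.{0} A B (i+1), a = 0 := by
      intro a
      obtain ⟨f, hf, rfl⟩ := P.extMk_surjective a (i+2) rfl
      rw [P.extMk_eq_zero_iff f (i+2) rfl hf i rfl]
      exact h f hf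
    rw [key a, key b]
  · intro h f hf
    have : P.extMk f (i+2) rfl hf = 0 := Subsingleton.elim _ _
    exact (P.extMk_eq_zero_iff f (i+2) rfl hf i rfl).1 this

variable {A B C X Y Z : Type} [AddCommGroup A] [Module R A] [AddCommGroup B] [Module R B]
  [AddCommGroup C] [Module R C] [AddCommGroup X] [Module R X] [AddCommGroup Y] [Module R Y]
  [AddCommGroup Z] [Module R Z]

lemma ez_iff (i : ℕ) : IsZero (ExtMod R (i+1) (ModuleCat.of R A) (ModuleCat.of R B)) ↔
    EZ R (i+1) A B := isZero_iff i _ _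

lemma ez_of_forall {i : ℕ} (h : ∀ a : Abelian.Ext.{0} (ModuleCat.of R A) (ModuleCat.of R B) i,
    a = 0) : EZ R i A B := ⟨fun a b => by rw [h a, h b]⟩

lemma EZ.eq_zero {i : ℕ} (h : EZ R i A B)
    (a : Abelian.Ext.{0} (ModuleCat.of R A) (ModuleCat.of R B) i) : a = 0 :=
  h.elim _ _

/-- A short exact sequence of modules. -/
structure SES (f : A →ₗ[R] B) (g : B →ₗ[R] C) : Prop where
  inj : Function.Injective f
  ex : Function.Exact f g
  surj : Function.Surjective g

/-- The associated short complex. -/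
abbrev SES.sc {f : A →ₗ[R] B} {g : B →ₗ[R] C} (h : SES f g) : ShortComplex (ModuleCat.{0} R) :=
  ShortComplex.mk (ModuleCat.ofHom f) (ModuleCat.ofHom g)
    (by ext x; exact h.ex.apply_apply_eq_zero x)

lemma SES.se {f : A →ₗ[R] B} {g : B →ₗ[R] C} (h : SES f g) : h.sc.ShortExact where
  exact := (ShortComplex.ShortExact.moduleCat_exact_iff_function_exact _).mpr h.ex
  mono_f := (ModuleCat.mono_iff_injective _).2 h.inj
  epi_g := (ModuleCat.epi_iff_surjective _).2 h.surj

section les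
variable {f : A →ₗ[R] B} {g : B →ₗ[R] C} (h : SES f g) {i : ℕ}
include h

lemma SES.cov2 (h1 : EZ R i X A) (h3 : EZ R i X C) : EZ R i X B := by
  refine ez_of_forall fun a => ?_
  obtain ⟨x, hx⟩ := Abelian.Ext.covariant_sequence_exact₂ _ h.se a (h3.eq_zero _)
  rw [← hx, h1.eq_zero x, Abelian.Ext.zero_comp]

lemma SES.cov1 (h3 : EZ R i X C) (h2 : EZ R (i+1) X B) : EZ R (i+1) X A := by
  refine ez_of_forall fun a => ?_
  obtain ⟨x, hx⟩ := Abelian.Ext.covariant_sequence_exact₁ _ h.se a (h2.eq_zero _) rfl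
  rw [← hx, h3.eq_zero x, Abelian.Ext.zero_comp]

lemma SES.cov3 (h2 : EZ R i X B) (h1 : EZ R (i+1) X A) : EZ R i X C := by
  refine ez_of_forall fun a => ?_
  obtain ⟨x, hx⟩ := Abelian.Ext.covariant_sequence_exact₃ _ h.se a rfl (h1.eq_zero _)
  rw [← hx, h2.eq_zero x, Abelian.Ext.zero_comp]

lemma SES.con2 (h1 : EZ R i A Y) (h3 : EZ R i C Y) : EZ R i B Y := by
  refine ez_of_forall fun a => ?_
  obtain ⟨x, hx⟩ := Abelian.Ext.contravariant_sequence_exact₂ h.se _ a (h1.eq_zero _)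
  rw [← hx, h3.eq_zero x, Abelian.Ext.comp_zero]

lemma SES.con1 (h2 : EZ R i B Y) (h3 : EZ R (i+1) C Y) : EZ R i A Y := by
  refine ez_of_forall fun a => ?_
  obtain ⟨x, hx⟩ := Abelian.Ext.contravariant_sequence_exact₁ h.se _ a (n₁ := i+1) (by omega)
    (h3.eq_zero _)
  rw [← hx, h2.eq_zero x, Abelian.Ext.comp_zero]

lemma SES.con3 (h1 : EZ R i A Y) (h2 : EZ R (i+1) B Y) : EZ R (i+1) C Y := by
  refine ez_of_forall fun a => ?_
  obtain ⟨x, hx⟩ := Abelian.Ext.contravariant_sequence_exact₃ h.se _ a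
    (h2.eq_zero _) (n₀ := i) (by omega)
  rw [← hx, h1.eq_zero x, Abelian.Ext.comp_zero]

lemma SES.extend (h3 : EZ R 1 C Y) (u : A →ₗ[R] Y) : ∃ v : B →ₗ[R] Y, v ∘ₗ f = u := by
  obtain ⟨x, hx⟩ := Abelian.Ext.contravariant_sequence_exact₁ h.se _
    (Abelian.Ext.mk₀ (ModuleCat.ofHom u)) (n₁ := 1) (by omega) (h3.eq_zero _)
  obtain ⟨v, rfl⟩ := (Abelian.Ext.mk₀_bijective _ _).2 x
  rw [Abelian.Ext.mk₀_comp_mk₀] at hx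
  have := (Abelian.Ext.mk₀_bijective _ _).1 hx
  exact ⟨v.hom, congrArg ModuleCat.Hom.hom this⟩

lemma SES.lift (h1 : EZ R 1 X A) (u : X →ₗ[R] C) : ∃ v : X →ₗ[R] B, g ∘ₗ v = u := by
  obtain ⟨x, hx⟩ := Abelian.Ext.covariant_sequence_exact₃ _ h.se
    (Abelian.Ext.mk₀ (ModuleCat.ofHom u)) (n₁ := 1) (by omega) (h1.eq_zero _)
  obtain ⟨v, rfl⟩ := (Abelian.Ext.mk₀_bijective _ _).2 x
  rw [Abelian.Ext.mk₀_comp_mk₀] at hx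
  have := (Abelian.Ext.mk₀_bijective _ _).1 hx
  exact ⟨v.hom, congrArg ModuleCat.Hom.hom this⟩

lemma SES.ez_one (h2 : EZ R 1 B Y) (hu : ∀ u : A →ₗ[R] Y, ∃ v : B →ₗ[R] Y, v ∘ₗ f = u) :
    EZ R 1 C Y := by
  refine ez_of_forall fun a => ?_
  obtain ⟨x, hx⟩ := Abelian.Ext.contravariant_sequence_exact₃ h.se _ a
    (h2.eq_zero _) (n₀ := 0) (by omega)
  obtain ⟨w, rfl⟩ := (Abelian.Ext.mk₀_bijective _ _).2 x
  obtain ⟨v, hv⟩ := hu w.hom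
  have : w = h.sc.f ≫ ModuleCat.ofHom v := by
    ext x
    exact (LinearMap.congr_fun hv x).symm
  rw [← hx, this, ← Abelian.Ext.mk₀_comp_mk₀, ← Abelian.Ext.comp_assoc (a₁₂ := 1) (a₂₃ := 0),
    h.se.extClass_comp, Abelian.Ext.zero_comp]
  all_goals rfl

end les

lemma ez_proj [Module.Projective R A] (i : ℕ) : EZ R (i+1) A Y := by
  have : Projective (ModuleCat.of R A) := (IsProjective.iff_projective A).1 inferInstance
  exact ez_of_forall fun a => Abelian.Ext.eq_zero_of_projective a

lemma EZ.retract_right {i : ℕ} (s : Y →ₗ[R] Z) (p : Z →ₗ[R] Y) (hps : p ∘ₗ s = LinearMap.id)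
    (h : EZ R i X Z) : EZ R i X Y := by
  refine ez_of_forall fun a => ?_
  have h1 : ModuleCat.ofHom s ≫ ModuleCat.ofHom p = 𝟙 (ModuleCat.of R Y) := by
    rw [← ModuleCat.ofHom_comp, hps]; rfl
  have h2 := h.eq_zero (a.comp (Abelian.Ext.mk₀ (ModuleCat.ofHom s)) (add_zero i))
  have h3 : (a.comp (Abelian.Ext.mk₀ (ModuleCat.ofHom s)) (add_zero i)).comp
    (Abelian.Ext.mk₀ (ModuleCat.ofHom p)) (add_zero i) = a := by
    rw [Abelian.Ext.comp_assoc (a₂₃ := 0), Abelian.Ext.mk₀_comp_mk₀, h1,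
      Abelian.Ext.comp_mk₀_id]
    all_goals rfl
  rw [← h3, h2, Abelian.Ext.zero_comp]

lemma EZ.retract_left {i : ℕ} (s : Y →ₗ[R] Z) (p : Z →ₗ[R] Y) (hps : p ∘ₗ s = LinearMap.id)
    (h : EZ R i Z X) : EZ R i Y X := by
  refine ez_of_forall fun a => ?_
  have h1 : ModuleCat.ofHom s ≫ ModuleCat.ofHom p = 𝟙 (ModuleCat.of R Y) := by
    rw [← ModuleCat.ofHom_comp, hps]; rfl
  have h2 := h.eq_zero ((Abelian.Ext.mk₀ (ModuleCat.ofHom p)).comp a (zero_add i))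
  have h3 : (Abelian.Ext.mk₀ (ModuleCat.ofHom s)).comp
    ((Abelian.Ext.mk₀ (ModuleCat.ofHom p)).comp a (zero_add i)) (zero_add i) = a := by
    rw [Abelian.Ext.mk₀_comp_mk₀_assoc, h1,
      Abelian.Ext.mk₀_id_comp]
  rw [← h3, h2, Abelian.Ext.comp_zero]

lemma EZ.congr_right {i : ℕ} (e : Y ≃ₗ[R] Z) (h : EZ R i X Z) : EZ R i X Y :=
  h.retract_right e.toLinearMap e.symm.toLinearMap (by ext; simp)

lemma EZ.congr_left {i : ℕ} (e : Y ≃ₗ[R] Z) (h : EZ R i Z X) : EZ R i Y X :=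
  h.retract_left e.toLinearMap e.symm.toLinearMap (by ext; simp)

lemma ez_subsingleton_right [Subsingleton Y] (i : ℕ) : EZ R i X Y := by
  refine ez_of_forall fun a => ?_
  rw [← Abelian.Ext.comp_mk₀_id a, (ModuleCat.isZero_of_subsingleton (ModuleCat.of R Y)).eq_of_src
    (𝟙 _) 0, Abelian.Ext.mk₀_zero, Abelian.Ext.comp_zero]

lemma ez_subsingleton_left [Subsingleton Y] (i : ℕ) : EZ R i Y X := by
  refine ez_of_forall fun a => ?_
  rw [← Abelian.Ext.mk₀_id_comp a, (ModuleCat.isZero_of_subsingleton (ModuleCat.of R Y)).eq_of_src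
    (𝟙 _) 0, Abelian.Ext.mk₀_zero, Abelian.Ext.zero_comp]

lemma ses_pi (n : ℕ) : SES (LinearMap.single R (fun _ : Fin (n+1) => Z) 0)
    (LinearMap.funLeft R Z (Fin.succ : Fin n → Fin (n+1))) where
  inj := Pi.single_injective (M := fun _ : Fin (n+1) => Z) 0
  ex := by
    intro y
    constructor
    · intro hy
      refine ⟨y 0, ?_⟩
      ext k
      refine Fin.cases ?_ (fun k => ?_) k
      · simp
      · have := congrFun hy k
        simp [LinearMap.funLeft_apply] at this
        simp [this]
    · rintro ⟨z, rfl⟩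
      ext k
      simp [LinearMap.funLeft_apply]
  surj := by
    intro y
    exact ⟨Fin.cons 0 y, by ext k; simp [LinearMap.funLeft_apply]⟩

lemma EZ.pi_right {i : ℕ} (h : EZ R i X Z) (n : ℕ) : EZ R i X (Fin n → Z) := by
  induction n with
  | zero => exact ez_subsingleton_right i
  | succ n ih => exact (ses_pi n).cov2 h ih

lemma EZ.pi_left {i : ℕ} (h : EZ R i Z X) (n : ℕ) : EZ R i (Fin n → Z) X := by
  induction n with
  | zero => exact ez_subsingleton_left i
  | succ n ih => exact (ses_pi n).con2 h ih

/-- Finite projective dimension bounds the nonvanishing of `Ext`. -/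
lemma ez_of_hasFinitePd (h : HasFinitePd R (ModuleCat.of R A)) :
    ∃ e : ℕ, ∀ (Y : Type) [AddCommGroup Y] [Module R Y], ∀ i, e < i → EZ R i A Y := by
  obtain ⟨n, G, ε, hp, hz, he, ⟨w, hw⟩, hex⟩ := h
  refine ⟨n, fun Y _ _ i hi => ez_of_forall fun a => ?_⟩
  let P : ProjectiveResolution (ModuleCat.of R A) :=
    { complex := G
      projective := hp
      π := (ChainComplex.toSingle₀Equiv _ _).symm ⟨ε, w⟩
      quasiIso := ⟨fun n => by
        cases n
        · rw [ChainComplex.quasiIsoAt₀_iff, ShortComplex.quasiIso_iff_of_zeros']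
          · refine (ShortComplex.exact_and_epi_g_iff_of_iso ?_).2
              ⟨hw, by dsimp; infer_instance⟩
            exact ShortComplex.isoMk (Iso.refl _) (Iso.refl _) (Iso.refl _)
              (by simp; exact (Category.id_comp _).trans (Category.comp_id _).symm)
              (by simp; exact (Category.id_comp _).trans (Category.comp_id _).symm)
          all_goals first | rfl | exact G.shape _ _ (by simp)
        · rw [quasiIsoAt_iff_exactAt']
          · exact hex _ (by omega)
          · apply ChainComplex.exactAt_succ_single_obj⟩ }
  obtain ⟨f, hf, rfl⟩ := P.extMk_surjective a (i+1) rfl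
  have : f = 0 := (hz i hi).eq_of_src _ _
  subst this
  simp

/-- Finite injective dimension bounds the nonvanishing of `Ext`. -/
lemma ez_of_hasFiniteInjDim (h : HasFiniteInjDim R (ModuleCat.of R A)) :
    ∃ e : ℕ, ∀ (Y : Type) [AddCommGroup Y] [Module R Y], ∀ i, e < i → EZ R i Y A := by
  obtain ⟨n, G, ε, hp, hz, he, ⟨w, hw⟩, hex⟩ := h
  refine ⟨n, fun Y _ _ i hi => ez_of_forall fun a => ?_⟩
  let P : InjectiveResolution (ModuleCat.of R A) :=
    { cocomplex := G
      injective := hp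
      ι := (CochainComplex.fromSingle₀Equiv _ _).symm ⟨ε, w⟩
      quasiIso := ⟨fun n => by
        cases n
        · rw [CochainComplex.quasiIsoAt₀_iff, ShortComplex.quasiIso_iff_of_zeros]
          · refine (ShortComplex.exact_and_mono_f_iff_of_iso ?_).2
              ⟨hw, by dsimp; infer_instance⟩
            exact ShortComplex.isoMk (Iso.refl _) (Iso.refl _) (Iso.refl _)
              (by simp; exact (Category.id_comp _).trans (Category.comp_id _).symm)
              (by simp; exact (Category.id_comp _).trans (Category.comp_id _).symm)
          all_goals first | rfl | exact G.shape _ _ (by simp)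
        · rw [quasiIsoAt_iff_exactAt]
          · exact hex _ (by omega)
          · apply CochainComplex.exactAt_succ_single_obj⟩ }
  obtain ⟨f, hf, rfl⟩ := P.extMk_surjective a (i+1) rfl
  have : f = 0 := (hz i hi).eq_of_tgt _ _
  subst this
  simp

lemma SES.desc {f : A →ₗ[R] B} {g : B →ₗ[R] C} (h : SES f g) (u : B →ₗ[R] Y)
    (hu : u ∘ₗ f = 0) : ∃ v : C →ₗ[R] Y, v ∘ₗ g = u := by
  let e := h.ex.linearEquivOfSurjective h.surj
  have hk : LinearMap.range f ≤ LinearMap.ker u := by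
    rintro _ ⟨x, rfl⟩
    exact LinearMap.congr_fun hu x
  refine ⟨(LinearMap.range f).liftQ u hk ∘ₗ e.symm.toLinearMap, ?_⟩
  ext b
  have : e (Submodule.Quotient.mk b) = g b := rfl
  simp [← this]

lemma ses_ker {p : B →ₗ[R] C} (hp : Function.Surjective p) : SES (LinearMap.ker p).subtype p where
  inj := Subtype.val_injective
  ex := LinearMap.exact_subtype_ker_map p
  surj := hp

lemma SES.dual {f : A →ₗ[R] B} {g : B →ₗ[R] C} (h : SES f g) (hC : EZ R 1 C R) :
    SES g.dualMap f.dualMap where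
  inj := LinearMap.dualMap_injective_of_surjective h.surj
  ex := by
    intro u
    constructor
    · intro hu
      obtain ⟨v, hv⟩ := h.desc u hu
      exact ⟨v, hv⟩
    · rintro ⟨v, rfl⟩
      ext a
      simp [h.ex.apply_apply_eq_zero a]
  surj := fun u => h.extend hC u

/-- Finitely generated with `Ext^i(X,R) = 0` for `i > 0`. -/
structure MCM (R : Type) [CommRing R] (X : Type) [AddCommGroup X] [Module R X] : Prop where
  fin : Module.Finite R X
  van : ∀ i, EZ R (i+1) X R

section gor

variable [IsNoetherianRing R]

lemma MCM.syz {n : ℕ} {f : A →ₗ[R] (Fin n → R)} {g : (Fin n → R) →ₗ[R] X} (h : SES f g)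
    (hX : MCM R X) : MCM R A where
  fin := Module.Finite.of_injective f h.inj
  van i := h.con1 (ez_proj i) (hX.van (i+1))

variable {d : ℕ} (hd : ∀ (Y : Type) [AddCommGroup Y] [Module R Y], ∀ i, d < i → EZ R i Y R)
include hd

lemma dual_van (k : ℕ) : ∀ (X : Type) [AddCommGroup X] [Module R X], MCM R X →
    ∀ i, d < i + 1 + k → EZ R (i+1) (Module.Dual R X) R := by
  induction k with
  | zero => intro X _ _ _ i hi; exact hd _ _ hi
  | succ k ih =>
    intro X _ _ hX i hi
    have := hX.fin
    obtain ⟨n, p, hp⟩ := Module.Finite.exists_fin' R X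
    have hs := ses_ker hp
    exact (hs.dual (hX.van 0)).con1 (ez_proj i) (ih _ (hX.syz hs) (i+1) (by omega))

lemma MCM.dual (hX : MCM R X) : MCM R (Module.Dual R X) where
  fin := by
    have := hX.fin
    obtain ⟨n, p, hp⟩ := Module.Finite.exists_fin' R X
    exact Module.Finite.of_injective p.dualMap (LinearMap.dualMap_injective_of_surjective hp)
  van i := dual_van hd (d+1) X hX i (by omega)

lemma eval_surj (hX : MCM R X) : Function.Surjective (Module.Dual.eval R X) := by
  have := hX.fin
  obtain ⟨n, g, hp⟩ := Module.Finite.exists_fin' R X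
  have hs := ses_ker hp
  have hA := hX.syz hs
  intro φ
  obtain ⟨ψ, hψ⟩ := (hs.dual (hX.van 0)).extend ((hA.dual hd).van 0) φ
  obtain ⟨y, rfl⟩ := (Module.bijective_dual_eval R (Fin n → R)).2 ψ
  exact ⟨g y, hψ⟩

lemma eval_inj (hX : MCM R X) : Function.Injective (Module.Dual.eval R X) := by
  have := hX.fin
  obtain ⟨n, g, hp⟩ := Module.Finite.exists_fin' R X
  have hs := ses_ker hp
  have hA := hX.syz hs
  rw [injective_iff_map_eq_zero]
  intro x hx
  obtain ⟨y, rfl⟩ := hp x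
  obtain ⟨φ, hφ⟩ := (hs.dual (hX.van 0)).desc (Module.Dual.eval R _ y) hx
  obtain ⟨a, rfl⟩ := eval_surj hd hA φ
  have : y = (LinearMap.ker g).subtype a := by
    apply (Module.bijective_dual_eval R (Fin n → R)).1
    exact hφ.symm
  rw [this]
  exact a.2

lemma cosyz (hX : MCM R X) : ∃ (G : Type) (_ : AddCommGroup G) (_ : Module R G)
    (X' : Type) (_ : AddCommGroup X') (_ : Module R X') (f : X →ₗ[R] G) (g : G →ₗ[R] X'),
    SES f g ∧ Module.Free R G ∧ Module.Finite R G ∧ MCM R X' := by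
  have hXd := hX.dual hd
  have := hXd.fin
  obtain ⟨n, q, hq⟩ := Module.Finite.exists_fin' R (Module.Dual R X)
  have hs := ses_ker hq
  have hL := hXd.syz hs
  have hsd := hs.dual (hXd.van 0)
  refine ⟨Module.Dual R (Fin n → R), inferInstance, inferInstance,
    Module.Dual R (LinearMap.ker q), inferInstance, inferInstance,
    q.dualMap ∘ₗ Module.Dual.eval R X, (LinearMap.ker q).subtype.dualMap, ⟨?_, ?_, ?_⟩,
    inferInstance, inferInstance, hL.dual hd⟩
  · exact hsd.inj.comp (eval_inj hd hX)
  · intro y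
    rw [hsd.ex y]
    constructor
    · rintro ⟨φ, rfl⟩
      obtain ⟨x, rfl⟩ := eval_surj hd hX φ
      exact ⟨x, rfl⟩
    · rintro ⟨x, rfl⟩
      exact ⟨_, rfl⟩
  · exact hsd.surj

end gor

/-- A class of modules closed under cosyzygies on which `Ext^i(-,Y)` vanishes for `i > 0`. -/
structure Core (R : Type) [CommRing R] (Y : Type) [AddCommGroup Y] [Module R Y]
    (P : (X : Type) → [AddCommGroup X] → [Module R X] → Prop) : Prop where
  mcm : ∀ (X : Type) [AddCommGroup X] [Module R X], P X → MCM R X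
  van : ∀ (X : Type) [AddCommGroup X] [Module R X], P X → ∀ i, EZ R (i+1) X Y
  cos : ∀ (X : Type) [AddCommGroup X] [Module R X], P X →
    ∃ (G : Type) (_ : AddCommGroup G) (_ : Module R G)
    (X' : Type) (_ : AddCommGroup X') (_ : Module R X') (f : X →ₗ[R] G) (g : G →ₗ[R] X'),
    SES f g ∧ Module.Free R G ∧ Module.Finite R G ∧ P X'

section core

variable {P : (X : Type) → [AddCommGroup X] → [Module R X] → Prop}

lemma Core.syz (hc : Core R Y P) {n : ℕ} {f : A →ₗ[R] (Fin n → R)} {g : (Fin n → R) →ₗ[R] Y}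
    (h : SES f g) : Core R A P where
  mcm := hc.mcm
  cos := hc.cos
  van := by
    have h2 : ∀ (X : Type) [AddCommGroup X] [Module R X], P X → ∀ i, EZ R (i+2) X A := by
      intro X _ _ hX i
      exact h.cov1 (hc.van X hX i) (((hc.mcm X hX).van (i+1)).pi_right n)
    intro X _ _ hX i
    obtain ⟨G, _, _, X', _, _, a, b, hs, _, _, hX'⟩ := hc.cos X hX
    exact hs.con1 (ez_proj i) (h2 X' hX' i)

lemma dth_nat (f : A →ₗ[R] B) (t : TensorProduct R (Module.Dual R B) Y) :
    dualTensorHom R A Y (TensorProduct.map f.dualMap LinearMap.id t) =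
      (dualTensorHom R B Y t) ∘ₗ f := by
  induction t with
  | zero => simp
  | add x y hx hy => simp [hx, hy, LinearMap.add_comp]
  | tmul x y => ext a; simp [dualTensorHom_apply]

lemma dth_free (G : Type) [AddCommGroup G] [Module R G] [Module.Free R G] [Module.Finite R G] :
    Function.Bijective (dualTensorHom R G Y) := by
  have := (dualTensorHomEquivOfBasis (N := Y) (Module.Free.chooseBasis R G)).bijective
  rwa [coe_dualTensorHomEquivOfBasis] at this

lemma Core.surj (hc : Core R Y P) (hX : P X) : Function.Surjective (dualTensorHom R X Y) := by
  obtain ⟨G, _, _, X', _, _, a, b, hs, _, _, hX'⟩ := hc.cos X hX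
  intro u
  obtain ⟨v, rfl⟩ := hs.extend (hc.van X' hX' 0) u
  obtain ⟨t, rfl⟩ := (dth_free (R := R) (Y := Y) G).2 v
  exact ⟨_, dth_nat a t⟩

lemma Core.inj (hc : Core R Y P) (hX : P X) : Function.Injective (dualTensorHom R X Y) := by
  obtain ⟨G, _, _, X', _, _, a, b, hs, _, _, hX'⟩ := hc.cos X hX
  rw [injective_iff_map_eq_zero]
  intro t ht
  have hsur : Function.Surjective (TensorProduct.map a.dualMap (LinearMap.id (R := R) (M := Y))) :=
    TensorProduct.map_surjective (hs.dual ((hc.mcm X' hX').van 0)).surj Function.surjective_id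
  obtain ⟨s, rfl⟩ := hsur t
  rw [dth_nat] at ht
  obtain ⟨v, hv⟩ := hs.desc _ ht
  obtain ⟨w, rfl⟩ := hc.surj hX' v
  rw [← dth_nat] at hv
  have := (dth_free (R := R) (Y := Y) G).1 hv
  rw [← this, ← LinearMap.comp_apply, ← TensorProduct.map_comp]
  have h0 : a.dualMap ∘ₗ b.dualMap = 0 := by
    ext l x; simp [hs.ex.apply_apply_eq_zero]
  rw [h0, TensorProduct.map_zero_left]
  rfl

lemma hom_ses {f : A →ₗ[R] B} {g : B →ₗ[R] C} (h : SES f g) (h1 : EZ R 1 X A) :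
    SES (f.compRight R (M := X)) (g.compRight R (M := X)) where
  inj := by
    intro u v huv
    ext x
    exact h.inj (LinearMap.congr_fun huv x)
  ex := by
    intro u
    constructor
    · intro hu
      have : ∀ x, ∃ a, f a = u x := fun x => (h.ex (u x)).1 (LinearMap.congr_fun hu x)
      let e := LinearEquiv.ofInjective f h.inj
      refine ⟨e.symm.toLinearMap ∘ₗ u.codRestrict (LinearMap.range f) this, ?_⟩
      ext x
      have h2 : f (e.symm (u.codRestrict (LinearMap.range f) this x)) =
        e (e.symm (u.codRestrict (LinearMap.range f) this x)) := rfl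
      simp only [LinearMap.compRight_apply, LinearMap.comp_apply, LinearEquiv.coe_coe]
      rw [h2, e.apply_symm_apply]
      rfl
    · rintro ⟨v, rfl⟩
      ext x
      exact h.ex.apply_apply_eq_zero (v x)
  surj := fun u => h.lift h1 u

end core

section core2

variable {P : (X : Type) → [AddCommGroup X] → [Module R X] → Prop} [IsNoetherianRing R]
variable {d : ℕ} (hd : ∀ (Y : Type) [AddCommGroup Y] [Module R Y], ∀ i, d < i → EZ R i Y R)
include hd

lemma Core.ext_one (hc : Core R Y P) (hX : P X) {n : ℕ} {f : A →ₗ[R] (Fin n → R)}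
    {g : (Fin n → R) →ₗ[R] Y} (h : SES f g) (hz : EZ R 1 (X →ₗ[R] Y) R) : EZ R 1 Y X := by
  refine h.ez_one (ez_proj 0) fun u => ?_
  have hcA := hc.syz h
  have hm := hc.mcm X hX
  let Φ := LinearEquiv.ofBijective (dualTensorHom R X A) ⟨hcA.inj hX, hcA.surj hX⟩
  obtain ⟨ψ, hψ⟩ := (hom_ses h (hcA.van X hX 0)).extend hz
    (TensorProduct.lift u.dualMap ∘ₗ Φ.symm.toLinearMap)
  let v0 : (Fin n → R) →ₗ[R] Module.Dual R (Module.Dual R X) :=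
    (TensorProduct.curry (ψ ∘ₗ dualTensorHom R X (Fin n → R))).flip
  let E := LinearEquiv.ofBijective (Module.Dual.eval R X) ⟨eval_inj hd hm, eval_surj hd hm⟩
  refine ⟨E.symm.toLinearMap ∘ₗ v0, ?_⟩
  ext y
  apply eval_inj hd hm
  have : Module.Dual.eval R X ((E.symm.toLinearMap ∘ₗ v0 ∘ₗ f) y) = v0 (f y) :=
    E.apply_symm_apply _
  refine this.trans ?_
  ext l
  have h1 : dualTensorHom R X (Fin n → R) (l ⊗ₜ[R] (f y)) =
      f.compRight R (dualTensorHom R X A (l ⊗ₜ[R] y)) := by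
    ext x; simp [dualTensorHom_apply]
  have h2 := LinearMap.congr_fun hψ (dualTensorHom R X A (l ⊗ₜ[R] y))
  have h3 : Φ.symm (dualTensorHom R X A (l ⊗ₜ[R] y)) = l ⊗ₜ[R] y := Φ.symm_apply_apply _
  simp only [LinearMap.comp_apply, LinearEquiv.coe_coe, h3] at h2
  change ψ (dualTensorHom R X (Fin n → R) (l ⊗ₜ[R] (f y))) = _
  rw [h1, h2]
  simp

omit hd [IsNoetherianRing R] in
lemma ez_hom_free {i : ℕ} (h : EZ R i (Module.Dual R X) Z) (n : ℕ) :
    EZ R i (X →ₗ[R] (Fin n → R)) Z := by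
  refine (h.pi_left n).retract_left
    (LinearMap.pi fun k => (LinearMap.proj k : (Fin n → R) →ₗ[R] R).compRight R)
    { toFun := fun u => LinearMap.pi u
      map_add' := fun u v => by ext; simp
      map_smul' := fun c u => by ext; simp } ?_
  ext u x k
  simp

lemma Core.ext_all (hX : P X) (i : ℕ) : ∀ (Y : Type) [AddCommGroup Y] [Module R Y]
    [Module.Finite R Y], Core R Y P → EZ R (i+1) (X →ₗ[R] Y) R → EZ R (i+1) Y X := by
  induction i with
  | zero =>
    intro Y _ _ _ hc hz
    obtain ⟨n, p, hp⟩ := Module.Finite.exists_fin' R Y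
    exact hc.ext_one hd hX (ses_ker hp) hz
  | succ i ih =>
    intro Y _ _ _ hc hz
    obtain ⟨n, p, hp⟩ := Module.Finite.exists_fin' R Y
    have hs := ses_ker hp
    have hcA := hc.syz hs
    refine hs.con3 (ih _ hcA ?_) (ez_proj _)
    exact (hom_ses hs (hcA.van X hX 0)).con1
      (ez_hom_free (((hc.mcm X hX).dual hd).van i) n) hz

end core2


/-- `Ext^i(A,B) = 0` for all large `i`. -/
def EV (R : Type) [CommRing R] (A B : Type) [AddCommGroup A] [Module R A]
    [AddCommGroup B] [Module R B] : Prop := ∃ n₀ : ℕ, ∀ i, n₀ ≤ i → EZ R (i+1) A B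

/-- Uniform bound for vanishing. -/
def Bd (R : Type) [CommRing R] (e : ℕ) (A : Type) [AddCommGroup A] [Module R A] : Prop :=
  ∀ (Y : Type) [AddCommGroup Y] [Module R Y], EV R A Y → ∀ i, e ≤ i → EZ R (i+1) A Y

lemma ev_left {f : A →ₗ[R] B} {g : B →ₗ[R] C} (h : SES f g) [Module.Projective R B] :
    EV R A Y ↔ EV R C Y := by
  constructor
  · rintro ⟨n, hn⟩
    refine ⟨n+1, fun i hi => ?_⟩
    obtain ⟨k, rfl⟩ : ∃ k, i = k + 1 := ⟨i-1, by omega⟩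
    exact h.con3 (hn k (by omega)) (ez_proj _)
  · rintro ⟨n, hn⟩
    exact ⟨n, fun i hi => h.con1 (ez_proj _) (hn (i+1) (by omega))⟩

lemma ev_right {f : A →ₗ[R] B} {g : B →ₗ[R] C} (h : SES f g) (hB : EV R X B) :
    EV R X A ↔ EV R X C := by
  obtain ⟨m, hm⟩ := hB
  constructor
  · rintro ⟨n, hn⟩
    exact ⟨n+m, fun i hi => h.cov3 (hm i (by omega)) (hn (i+1) (by omega))⟩
  · rintro ⟨n, hn⟩
    refine ⟨n+m+1, fun i hi => ?_⟩
    obtain ⟨k, rfl⟩ : ∃ k, i = k + 1 := ⟨i-1, by omega⟩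
    exact h.cov1 (hn k (by omega)) (hm _ (by omega))

section pushout

variable [IsLocalRing R]

/-- The `j`-th syzygy as a cokernel. -/
abbrev Cok {N : Type} [AddCommGroup N] [Module R N] (F : MinFreeRes R N) (j : ℕ) : Type :=
  (Fin (F.b j) → R) ⧸ LinearMap.range (F.d j)

variable {N : Type} [AddCommGroup N] [Module R N] (F : MinFreeRes R N)

lemma cok_zero : Nonempty (Cok F 0 ≃ₗ[R] N) :=
  ⟨(Submodule.quotEquivOfEq _ _ F.exact_zero.symm).trans
    (F.aug.quotKerEquivOfSurjective F.aug_surj)⟩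

lemma cok_ses (j : ℕ) : SES ((LinearMap.range (F.d (j+1))).liftQ (F.d j) (F.exact_succ j).ge)
    (LinearMap.range (F.d j)).mkQ where
  inj := by
    rw [← LinearMap.ker_eq_bot]
    exact Submodule.ker_liftQ_eq_bot _ _ _ (F.exact_succ j).le
  ex := by
    rw [LinearMap.exact_iff, Submodule.ker_mkQ, Submodule.range_liftQ]
  surj := Submodule.mkQ_surjective _

lemma cok_left (j : ℕ) : ∀ i, EZ R (i+1+j) N Y ↔ EZ R (i+1) (Cok F j) Y := by
  induction j with
  | zero =>
    intro i
    obtain ⟨e⟩ := cok_zero F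
    exact ⟨fun h => EZ.congr_left e h, fun h => EZ.congr_left e.symm h⟩
  | succ j ih =>
    intro i
    rw [show i+1+(j+1) = (i+1)+1+j by omega, ih (i+1)]
    exact ⟨fun h => (cok_ses F j).con1 (ez_proj i) h,
      fun h => (cok_ses F j).con3 h (ez_proj _)⟩

lemma cok_right (hX : ∀ i, EZ R (i+1) X R) (j : ℕ) :
    ∀ i, EZ R (i+1+j) X (Cok F j) ↔ EZ R (i+1) X N := by
  induction j with
  | zero =>
    intro i
    obtain ⟨e⟩ := cok_zero F
    exact ⟨fun h => EZ.congr_right e.symm h, fun h => EZ.congr_right e h⟩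
  | succ j ih =>
    intro i
    rw [← ih i]
    have hF : ∀ m, EZ R (m+1) X (Fin (F.b j) → R) := fun m => (hX m).pi_right _
    constructor
    · intro h
      refine (cok_ses F j).cov3 ?_ h
      rw [show i+1+j = (i+j)+1 by omega]
      exact hF _
    · intro h
      exact (cok_ses F j).cov1 h (hF _)

lemma push_ses (j : ℕ) (f : LinearMap.range (F.d j) →ₗ[R] N) :
    ∃ (a : N →ₗ[R] PushoutMod R F j f) (b : PushoutMod R F j f →ₗ[R] Cok F j), SES a b := by
  let S := LinearMap.range (LinearMap.prod f (-(LinearMap.range (F.d j)).subtype))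
  let q : (N × (Fin (F.b j) → R)) →ₗ[R] Cok F j :=
    (LinearMap.range (F.d j)).mkQ ∘ₗ LinearMap.snd R _ _
  have hq : S ≤ LinearMap.ker q := by
    rintro _ ⟨x, rfl⟩
    simp [q]
  refine ⟨S.mkQ ∘ₗ LinearMap.inl R _ _, S.liftQ q hq, ⟨?_, ?_, ?_⟩⟩
  · rw [injective_iff_map_eq_zero]
    intro x hx
    have : (x, (0 : Fin (F.b j) → R)) ∈ S := by simpa using hx
    obtain ⟨y, hy⟩ := this
    have h1 : f y = x := congrArg Prod.fst hy
    have h2 : -(y : Fin (F.b j) → R) = 0 := congrArg Prod.snd hy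
    have : y = 0 := Subtype.ext (neg_eq_zero.1 h2)
    rw [← h1, this, map_zero]
  · intro z
    obtain ⟨⟨x, y⟩, rfl⟩ := S.mkQ_surjective z
    constructor
    · intro h
      have hy : y ∈ LinearMap.range (F.d j) := by simpa [q] using h
      refine ⟨x + f ⟨y, hy⟩, ?_⟩
      rw [LinearMap.comp_apply, ← sub_eq_zero, ← map_sub, ← LinearMap.mem_ker, Submodule.ker_mkQ]
      exact ⟨⟨y, hy⟩, by ext <;> simp⟩
    · rintro ⟨n, hn⟩
      rw [← hn]
      simp [q]
  · intro z
    obtain ⟨y, rfl⟩ := Submodule.mkQ_surjective _ z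
    exact ⟨S.mkQ (0, y), by simp [q]⟩

omit F in
lemma lemQ (c : ℕ) : ∀ (N : Type) [g : AddCommGroup N] [m : Module R N], RedCxAux R c N g m →
    ∃ e, Bd R e N := by
  have base : ∀ (N : Type) [g : AddCommGroup N] [m : Module R N],
      HasFinitePd R (ModuleCat.of R N) → ∃ e, Bd R e N := by
    intro N _ _ h
    obtain ⟨e, he⟩ := ez_of_hasFinitePd h
    exact ⟨e, fun Y _ _ _ i hi => he Y _ (by omega)⟩
  induction c with
  | zero => intro N g m h; exact base N h
  | succ c ih =>
    intro N g m h
    rcases h with h | ⟨-, -, j, F, f, -, -, h⟩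
    · exact base N h
    obtain ⟨e, he⟩ := ih _ h
    refine ⟨e, fun Y _ _ hY => ?_⟩
    obtain ⟨n, hn⟩ := hY
    obtain ⟨a, b, hs⟩ := push_ses F j f
    have hK := he Y ⟨n, fun i hi => hs.con2 (hn i hi) ((cok_left F j i).1 (by
      rw [show i+1+j = (i+j)+1 by omega]; exact hn _ (by omega)))⟩
    have key : ∀ k i, e ≤ i → n ≤ i + k → EZ R (i+1) N Y := by
      intro k
      induction k with
      | zero => intro i _ h2; exact hn i h2
      | succ k ih2 =>
        intro i h1 h2
        refine hs.con1 (hK i h1) ((cok_left F j (i+1)).1 ?_)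
        rw [show i+1+1+j = (i+1+j)+1 by omega]
        exact ih2 _ (by omega) (by omega)
    exact fun i hi => key n i hi (by omega)

end pushout

lemma pd_van [IsNoetherianRing R] (hX : ∀ i, EZ R (i+1) X R) (e : ℕ) :
    ∀ (N : Type) [AddCommGroup N] [Module R N] [Module.Finite R N],
    (∀ (Y : Type) [AddCommGroup Y] [Module R Y], ∀ i, e < i → EZ R i N Y) →
    ∀ i, EZ R (i+1) X N := by
  induction e with
  | zero =>
    intro N _ _ _ h i
    obtain ⟨n, p, hp⟩ := Module.Finite.exists_fin' R N
    obtain ⟨v, hv⟩ := (ses_ker hp).lift (h _ 1 (by omega)) LinearMap.id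
    exact ((hX i).pi_right n).retract_right v p hv
  | succ e ih =>
    intro N _ _ _ h i
    obtain ⟨n, p, hp⟩ := Module.Finite.exists_fin' R N
    have hs := ses_ker hp
    refine hs.cov3 ((hX i).pi_right n) (ih _ ?_ (i+1))
    intro Y _ _ k hk
    obtain ⟨l, rfl⟩ : ∃ l, k = l + 1 := ⟨k-1, by omega⟩
    exact hs.con1 (ez_proj l) (h Y _ (by omega))

lemma lemP [IsLocalRing R] [IsNoetherianRing R] (hX : ∀ i, EZ R (i+1) X R) (c : ℕ) :
    ∀ (N : Type) [g : AddCommGroup N] [m : Module R N] [Module.Finite R N],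
    RedCxAux R c N g m → EV R X N → ∀ i, EZ R (i+1) X N := by
  have base : ∀ (N : Type) [g : AddCommGroup N] [m : Module R N] [Module.Finite R N],
      HasFinitePd R (ModuleCat.of R N) → ∀ i, EZ R (i+1) X N := by
    intro N _ _ _ h
    obtain ⟨e, he⟩ := ez_of_hasFinitePd h
    exact pd_van hX e N he
  induction c with
  | zero => intro N g m _ h _; exact base N h
  | succ c ih =>
    intro N g m _ h hev
    rcases h with h | ⟨-, -, j, F, f, -, -, h⟩
    · exact base N h
    obtain ⟨n, hn⟩ := hev
    obtain ⟨a, b, hs⟩ := push_ses F j f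
    have hK := ih _ h ⟨n+j, fun i hi => hs.cov2 (hn i (by omega)) (by
      obtain ⟨k, rfl⟩ : ∃ k, i = k + j := ⟨i-j, by omega⟩
      rw [show k+j+1 = k+1+j by omega]
      exact (cok_right F hX j k).2 (hn _ (by omega)))⟩
    have key : ∀ k i, n ≤ i + k → EZ R (i+1) X N := by
      intro k
      induction k with
      | zero => intro i h2; exact hn i h2
      | succ k ih2 =>
        intro i h2
        rw [← cok_right F hX j i]
        refine hs.cov3 ?_ (ih2 _ (by omega))
        rw [show i+1+j = (i+j)+1 by omega]
        exact hK _
    exact fun i => key n i (by omega)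

section fin

variable [IsNoetherianRing R]
variable {d : ℕ} (hd : ∀ (Y : Type) [AddCommGroup Y] [Module R Y], ∀ i, d < i → EZ R i Y R)
include hd

lemma ev_free (n : ℕ) : EV R X (Fin n → R) :=
  ⟨d, fun i hi => (hd X (i+1) (by omega)).pi_right n⟩

lemma mcm_syz (k : ℕ) : ∀ (M : Type) [AddCommGroup M] [Module R M] [Module.Finite R M],
    (∀ i, k ≤ i → EZ R (i+1) M R) →
    ∃ (X : Type) (_ : AddCommGroup X) (_ : Module R X), MCM R X ∧
      (∀ (Z : Type) [AddCommGroup Z] [Module R Z], EV R X Z ↔ EV R M Z) ∧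
      (∀ (Z : Type) [AddCommGroup Z] [Module R Z], EV R Z X ↔ EV R Z M) ∧
      (∀ e, Bd R e M → Bd R e X) := by
  induction k with
  | zero =>
    intro M _ _ _ h
    exact ⟨M, inferInstance, inferInstance, ⟨inferInstance, fun i => h i (by omega)⟩,
      fun Z _ _ => Iff.rfl, fun Z _ _ => Iff.rfl, fun e h => h⟩
  | succ k ih =>
    intro M _ _ _ h
    obtain ⟨n, p, hp⟩ := Module.Finite.exists_fin' R M
    have hs := ses_ker hp
    obtain ⟨X, _, _, h1, h2, h3, h4⟩ := ih (LinearMap.ker p)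
      (fun i hi => hs.con1 (ez_proj i) (h (i+1) (by omega)))
    refine ⟨X, inferInstance, inferInstance, h1, fun Z _ _ => (h2 Z).trans (ev_left hs),
      fun Z _ _ => (h3 Z).trans (ev_right hs (ev_free hd n)), fun e he => h4 e ?_⟩
    intro Y _ _ hY i hi
    exact hs.con1 (ez_proj i) (he Y ((ev_left hs).1 hY) (i+1) (by omega))

lemma bd_van (hX : MCM R X) {e : ℕ} (he : Bd R e X) (k : ℕ) :
    ∀ (Y : Type) [AddCommGroup Y] [Module R Y] [Module.Finite R Y], EV R X Y →
      ∀ i, e ≤ i + k → EZ R (i+1) X Y := by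
  induction k with
  | zero => intro Y _ _ _ hY i hi; exact he Y hY i hi
  | succ k ih =>
    intro Y _ _ _ hY i hi
    obtain ⟨n, p, hp⟩ := Module.Finite.exists_fin' R Y
    have hs := ses_ker hp
    exact hs.cov3 ((hX.van i).pi_right n)
      (ih _ ((ev_right hs (ev_free hd n)).2 hY) (i+1) (by omega))

lemma forward [IsLocalRing R] {M N : Type} [AddCommGroup M] [Module R M] [Module.Finite R M]
    [AddCommGroup N] [Module R N] [Module.Finite R N]
    (hred : HasReducibleComplexity R N) (h : EV R M N) : EV R N M := by
  obtain ⟨c, hc⟩ := hred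
  obtain ⟨X, _, _, h1, h2, h3, -⟩ := mcm_syz hd d M (fun i hi => hd M _ (by omega))
  rw [← h2] at h
  rw [← h3]
  have core : Core R N (fun X [AddCommGroup X] [Module R X] => MCM R X ∧ EV R X N) :=
    { mcm := fun X _ _ hX => hX.1
      van := fun X _ _ hX => lemP hX.1.van c N hc hX.2
      cos := fun X _ _ hX => by
        obtain ⟨G, _, _, X', _, _, f, g, hs, hG, hG', hX'⟩ := cosyz hd hX.1
        exact ⟨G, _, _, X', _, _, f, g, hs, hG, hG', hX', (ev_left hs).1 hX.2⟩ }
  exact ⟨d, fun i hi => Core.ext_all (X := X) hd ⟨h1, h⟩ i N core (hd _ _ (by omega))⟩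

lemma backward [IsLocalRing R] {M N : Type} [AddCommGroup M] [Module R M] [Module.Finite R M]
    [AddCommGroup N] [Module R N] [Module.Finite R N]
    (hred : HasReducibleComplexity R N) (h : EV R N M) : EV R M N := by
  obtain ⟨c, hc⟩ := hred
  obtain ⟨e, he⟩ := lemQ c N hc
  obtain ⟨X, _, _, h1, h2, h3, h4⟩ := mcm_syz hd d N (fun i hi => hd N _ (by omega))
  rw [← h2] at h
  rw [← h3]
  have core : Core R M (fun X [AddCommGroup X] [Module R X] =>
      MCM R X ∧ (∃ e, Bd R e X) ∧ EV R X M) :=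
    { mcm := fun X _ _ hX => hX.1
      van := fun X _ _ hX i => by
        obtain ⟨hm, ⟨e, he⟩, hv⟩ := hX
        exact bd_van hd hm he e M hv i (by omega)
      cos := fun X _ _ hX => by
        obtain ⟨hm, ⟨e, he⟩, hv⟩ := hX
        obtain ⟨G, _, _, X', _, _, f, g, hs, hG, hG', hX'⟩ := cosyz hd hm
        refine ⟨G, _, _, X', _, _, f, g, hs, hG, hG', hX', ⟨e+1, ?_⟩, (ev_left hs).1 hv⟩
        intro Y _ _ hY i hi
        obtain ⟨k, rfl⟩ : ∃ k, i = k + 1 := ⟨i-1, by omega⟩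
        exact hs.con3 (he Y ((ev_left hs).2 hY) k (by omega)) (ez_proj _) }
  exact ⟨d, fun i hi => Core.ext_all (X := X) hd ⟨h1, ⟨e, h4 e he⟩, h⟩ i M core
    (hd _ _ (by omega))⟩

end fin

lemma ev_iff : (∃ n₀ : ℕ, ∀ i : ℕ, n₀ ≤ i →
      IsZero (ExtMod R i (ModuleCat.of R A) (ModuleCat.of R B))) ↔ EV R A B := by
  constructor
  · rintro ⟨n, hn⟩
    exact ⟨n, fun i hi => (ez_iff i).1 (hn (i+1) (by omega))⟩
  · rintro ⟨n, hn⟩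
    refine ⟨n+1, fun i hi => ?_⟩
    obtain ⟨k, rfl⟩ : ∃ k, i = k + 1 := ⟨i-1, by omega⟩
    exact (ez_iff k).2 (hn k (by omega))

end RC

/-- Let `R` be a Gorenstein local ring and `M`, `N` finitely generated `R`-modules where
`N` has reducible complexity (e.g. `CI-dim_R N < ∞`). Then `Ext^i_R(M,N) = 0` for all
`i ≫ 0` iff `Ext^i_R(N,M) = 0` for all `i ≫ 0`. -/
theorem stmt_9 (R : Type) [CommRing R] [IsLocalRing R] (hR : IsGorensteinLocalRing R)
    (M N : Type) [AddCommGroup M] [Module R M] [Module.Finite R M]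
    [AddCommGroup N] [Module R N] [Module.Finite R N]
    (hred : HasReducibleComplexity R N) :
    (∃ n₀ : ℕ, ∀ i : ℕ, n₀ ≤ i →
      IsZero (ExtMod R i (ModuleCat.of R M) (ModuleCat.of R N))) ↔
    (∃ n₀ : ℕ, ∀ i : ℕ, n₀ ≤ i →
      IsZero (ExtMod R i (ModuleCat.of R N) (ModuleCat.of R M))) := by
  have := hR.2.1
  obtain ⟨d, hd⟩ := RC.ez_of_hasFiniteInjDim hR.2.2
  rw [RC.ev_iff, RC.ev_iff]
  exact ⟨RC.forward hd hred, RC.backward hd hred⟩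

end
end

section
/- Let M and N be nonzero finitely generated R-modules over a local ring R with G-dim_R(M) < ∞. If Êxt^i_R(M,N) = 0 for all i ≥ G-dim_R(M) − 1, then: (i) sup{ i : Ext^i_R(M,N) ≠ 0 } = depth R − depth_R(M); and (ii) Ext^{g}_R(M,N) ≅ Ext^{g}_R(M,R) ⊗_R N, where g = G-dim_R(M). -/
open CategoryTheory CategoryTheory.Limits CategoryTheory.MonoidalCategory Opposite

noncomputable section

universe u

variable (R : Type u) [CommRing R]

section PartB
variable {R}

/-- Vanishing of the complex `Hom(X, N)` in one spot, in elementary terms. -/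
lemma lyo_exactAt_iff {α : Type} [AddRightCancelSemigroup α] [One α]
    (X : ChainComplex (ModuleCat.{u} R) α) (N : ModuleCat.{u} R) (i j k : α)
    (hij : i + 1 = j) (hjk : j + 1 = k) :
    (X.linearYonedaObj R N).ExactAt j ↔
      ∀ f : X.X j ⟶ N, X.d k j ≫ f = 0 → ∃ h : X.X i ⟶ N, X.d j i ≫ h = f := by
  rw [HomologicalComplex.exactAt_iff' _ i j k ((ComplexShape.up α).prev_eq' hij) ((ComplexShape.up α).next_eq' hjk)]
  rw [ShortComplex.moduleCat_exact_iff]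
  rfl

lemma extMod_isZero_iff {M : ModuleCat.{u} R} (Q : ProjectiveResolution M) (N : ModuleCat.{u} R)
    (n : ℕ) : IsZero (ExtMod R (n + 1) M N) ↔
      ∀ f : Q.complex.X (n+1) ⟶ N, Q.complex.d (n+2) (n+1) ≫ f = 0 →
        ∃ h : Q.complex.X n ⟶ N, Q.complex.d (n+1) n ≫ h = f := by
  rw [(Q.isoExt (R := R) (n+1) N).isZero_iff, ← HomologicalComplex.exactAt_iff_isZero_homology]
  exact lyo_exactAt_iff _ _ _ _ _ rfl rfl

lemma ext_subsingleton_iff {M : ModuleCat.{u} R} (Q : ProjectiveResolution M) (N : ModuleCat.{u} R)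
    (n : ℕ) : Subsingleton (Abelian.Ext M N (n+1)) ↔
      ∀ f : Q.complex.X (n+1) ⟶ N, Q.complex.d (n+2) (n+1) ≫ f = 0 →
        ∃ h : Q.complex.X n ⟶ N, Q.complex.d (n+1) n ≫ h = f := by
  constructor
  · intro hs f hf
    exact (Q.extMk_eq_zero_iff f (n+2) rfl hf n rfl).1 (Subsingleton.elim _ _)
  · intro h
    refine subsingleton_of_forall_eq 0 fun α => ?_
    obtain ⟨f, hf, rfl⟩ := Q.extMk_surjective α (n+2) rfl
    exact (Q.extMk_eq_zero_iff f (n+2) rfl hf n rfl).2 (h f hf)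

lemma extMod_isZero_iff_subsingleton (M N : ModuleCat.{u} R) (n : ℕ) :
    IsZero (ExtMod R (n + 1) M N) ↔ Subsingleton (Abelian.Ext M N (n+1)) := by
  rw [extMod_isZero_iff (ProjectiveResolution.of M), ext_subsingleton_iff]

/-- A projective resolution from elementary data. -/
def mkRes {M : ModuleCat.{u} R} (X : ChainComplex (ModuleCat.{u} R) ℕ) (ε : X.X 0 ⟶ M)
    (hp : ∀ n, Projective (X.X n)) (w : X.d 1 0 ≫ ε = 0) (he : Epi ε)
    (h0 : (ShortComplex.mk (X.d 1 0) ε w).Exact) (hs : ∀ n, X.ExactAt (n+1)) :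
    ProjectiveResolution M where
  complex := X
  projective := hp
  π := (ChainComplex.toSingle₀Equiv _ _).symm ⟨ε, w⟩
  quasiIso := ⟨fun n => by
    cases n with
    | zero =>
      rw [ChainComplex.quasiIsoAt₀_iff, ShortComplex.quasiIso_iff_of_zeros']
      · have := And.intro h0 he
        have e : ((ChainComplex.toSingle₀Equiv X M).symm ⟨ε, w⟩).f 0 = ε :=
          ChainComplex.toSingle₀Equiv_symm_apply_f_zero _ _
        exact this
      · exact X.shape _ _ (by simp)
      all_goals rfl
    | succ n =>
      rw [quasiIsoAt_iff_exactAt']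
      · exact hs n
      · apply ChainComplex.exactAt_succ_single_obj⟩

/-- The augmentation of a projective resolution. -/
def resπ {M : ModuleCat.{u} R} (Q : ProjectiveResolution M) : Q.complex.X 0 ⟶ M := Q.π.f 0

lemma resπ_w {M : ModuleCat.{u} R} (Q : ProjectiveResolution M) :
    Q.complex.d 1 0 ≫ resπ Q = 0 := Q.complex_d_comp_π_f_zero

instance resπ_epi {M : ModuleCat.{u} R} (Q : ProjectiveResolution M) : Epi (resπ Q) :=
  inferInstanceAs (Epi (Q.π.f 0))

lemma resπ_exact {M : ModuleCat.{u} R} (Q : ProjectiveResolution M) :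
    (ShortComplex.mk _ _ (resπ_w Q)).Exact := Q.exact₀

lemma aug_w (S : ShortComplex (ModuleCat.{u} R)) (Q : ProjectiveResolution S.X₁) :
    Q.complex.d 1 0 ≫ resπ Q ≫ S.f = 0 := by
  rw [← Category.assoc, resπ_w, zero_comp]

lemma aug_exact0 (S : ShortComplex (ModuleCat.{u} R)) (hS : S.ShortExact)
    {X : ModuleCat.{u} R} (e : X ⟶ S.X₁) [Epi e] (w : (e ≫ S.f) ≫ S.g = 0) :
    (ShortComplex.mk (e ≫ S.f) S.g w).Exact := by
  let φ : ShortComplex.mk (e ≫ S.f) S.g w ⟶ S := { τ₁ := e, τ₂ := 𝟙 _, τ₃ := 𝟙 _ }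
  have : Epi φ.τ₁ := ‹Epi e›
  have : IsIso φ.τ₂ := inferInstanceAs (IsIso (𝟙 _))
  have : Mono φ.τ₃ := inferInstanceAs (Mono (𝟙 _))
  exact (ShortComplex.exact_iff_of_epi_of_isIso_of_mono φ).2 hS.exact

lemma aug_exact1 (S : ShortComplex (ModuleCat.{u} R)) {A : ModuleCat.{u} R} (m : S.X₃ ⟶ A) [Mono m]
    (hS : S.Exact) (w : S.f ≫ S.g ≫ m = 0) :
    (ShortComplex.mk S.f (S.g ≫ m) w).Exact := by
  let φ : S ⟶ ShortComplex.mk S.f (S.g ≫ m) w := { τ₁ := 𝟙 _, τ₂ := 𝟙 _, τ₃ := m }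
  have : Epi φ.τ₁ := inferInstanceAs (Epi (𝟙 _))
  have : IsIso φ.τ₂ := inferInstanceAs (IsIso (𝟙 _))
  have : Mono φ.τ₃ := ‹Mono m›
  exact (ShortComplex.exact_iff_of_epi_of_isIso_of_mono φ).1 hS

lemma aug_exactAt (S : ShortComplex (ModuleCat.{u} R)) (hS : S.ShortExact)
    (X : ChainComplex (ModuleCat.{u} R) ℕ) (e : X.X 0 ⟶ S.X₁)
    (w : X.d 1 0 ≫ e = 0) (w' : X.d 1 0 ≫ e ≫ S.f = 0)
    (h0 : (ShortComplex.mk (X.d 1 0) e w).Exact) (hs : ∀ n, X.ExactAt (n+1)) (n : ℕ) :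
    (X.augment (e ≫ S.f) w').ExactAt (n+1) := by
  have hm := hS.mono_f
  rw [HomologicalComplex.exactAt_iff' _ (n + 1 + 1) (n + 1) n (by simp) (by simp)]
  cases n with
  | zero => exact aug_exact1 _ S.f h0 w'
  | succ n =>
    have := hs n
    rw [HomologicalComplex.exactAt_iff' _ (n + 1 + 1) (n + 1) n (by simp) (by simp)] at this
    exact this

/-- Splice a projective resolution of the kernel. -/
def augRes (S : ShortComplex (ModuleCat.{u} R)) (hS : S.ShortExact) [Projective S.X₂]
    (Q : ProjectiveResolution S.X₁) : ProjectiveResolution S.X₃ :=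
  mkRes (Q.complex.augment (X := S.X₂) (resπ Q ≫ S.f) (aug_w S Q)) S.g
    (by
      rintro (_|n)
      · assumption
      · exact Q.projective n)
    (by
      change (resπ Q ≫ S.f) ≫ S.g = 0
      rw [Category.assoc, S.zero, comp_zero])
    hS.epi_g (aug_exact0 S hS (resπ Q) _)
    (aug_exactAt S hS _ _ (resπ_w Q) _ (resπ_exact Q) fun n => by
      rw [HomologicalComplex.exactAt_iff' _ (n + 1 + 1) (n + 1) n (by simp) (by simp)]
      exact Q.exact_succ n)

end PartB

section PartC
variable {R}

lemma sc_homology_pres (T : ShortComplex (ModuleCat.{u} R)) {V : Type u} [AddCommGroup V]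
    [Module R V] (j : V →ₗ[R] T.X₂) (hj : ∀ x : T.X₂, T.g x = 0 ↔ ∃ v, j v = x) :
    ∃ φ : V →ₗ[R] T.homology, Function.Surjective φ ∧
      ∀ v, φ v = 0 ↔ ∃ y : T.X₁, T.f y = j v := by
  let j' : V →ₗ[R] LinearMap.ker T.g.hom := j.codRestrict _ (fun v => (hj _).2 ⟨v, rfl⟩)
  have hj' : Function.Surjective j' := by
    rintro ⟨x, hx⟩
    obtain ⟨v, hv⟩ := (hj x).1 hx
    exact ⟨v, Subtype.ext hv⟩
  let e : T.homology ≃ₗ[R] T.moduleCatLeftHomologyData.H := T.moduleCatHomologyIso.toLinearEquiv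
  let q : LinearMap.ker T.g.hom →ₗ[R] T.moduleCatLeftHomologyData.H :=
    (LinearMap.range T.moduleCatToCycles).mkQ
  refine ⟨e.symm.toLinearMap ∘ₗ q ∘ₗ j', ?_, ?_⟩
  · exact e.symm.surjective.comp ((Submodule.mkQ_surjective _).comp hj')
  · intro v
    have h1 : (e.symm.toLinearMap ∘ₗ q ∘ₗ j') v = 0 ↔ q (j' v) = 0 := by simp
    rw [h1]
    have h2 : q (j' v) = 0 ↔ j' v ∈ LinearMap.range T.moduleCatToCycles :=
      Submodule.Quotient.mk_eq_zero _
    rw [h2]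
    constructor
    · rintro ⟨y, hy⟩
      exact ⟨y, congrArg Subtype.val hy⟩
    · rintro ⟨y, hy⟩
      exact ⟨y, Subtype.ext hy⟩

lemma cochain_homology_pres {α : Type} [AddRightCancelSemigroup α] [One α]
    (X : CochainComplex (ModuleCat.{u} R) α) (i k l : α) 
    (hi : (ComplexShape.up α).prev k = i) (hl : (ComplexShape.up α).next k = l)
    {V : Type u} [AddCommGroup V]
    [Module R V] (j : V →ₗ[R] X.X k) (hj : ∀ x : X.X k, X.d k l x = 0 ↔ ∃ v, j v = x) :
    ∃ φ : V →ₗ[R] X.homology k, Function.Surjective φ ∧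
      ∀ v, φ v = 0 ↔ ∃ y : X.X i, X.d i k y = j v := by
  obtain ⟨φ, h1, h2⟩ := sc_homology_pres (X.sc' i k l) j hj
  let e : X.homology k ≃ₗ[R] (X.sc' i k l).homology := (X.homologyIsoSc' i k l hi hl).toLinearEquiv
  refine ⟨e.symm.toLinearMap ∘ₗ φ, e.symm.surjective.comp h1, fun v => ?_⟩
  have : (e.symm.toLinearMap ∘ₗ φ) v = 0 ↔ φ v = 0 := by simp
  rw [this, h2]
  rfl

/-- precomposition with a morphism, as a linear map from unbundled homs. -/
def preL {X Y : ModuleCat.{u} R} (p : X ⟶ Y) (N : ModuleCat.{u} R) :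
    (Y →ₗ[R] N) →ₗ[R] (X ⟶ N) where
  toFun f := p ≫ ModuleCat.ofHom f
  map_add' f g := by simp [ModuleCat.ofHom_add]
  map_smul' r f := by ext; simp

lemma preL_resπ {M : ModuleCat.{u} R} (Q : ProjectiveResolution M) (N : ModuleCat.{u} R)
    (x : Q.complex.X 0 ⟶ N) : Q.complex.d 1 0 ≫ x = 0 ↔ ∃ v, preL (resπ Q) N v = x := by
  constructor
  · intro h
    let l := (resπ_exact Q).desc x h
    refine ⟨l.hom, ?_⟩
    exact (resπ_exact Q).g_desc x h
  · rintro ⟨v, rfl⟩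
    change _ ≫ _ ≫ _ = 0
    rw [← Category.assoc, resπ_w, zero_comp]

lemma extMod_zero_equiv (M N : ModuleCat.{u} R) :
    Nonempty ((M →ₗ[R] N) ≃ₗ[R] ExtMod R 0 M N) := by
  let Q := ProjectiveResolution.of M
  obtain ⟨φ, h1, h2⟩ := cochain_homology_pres (Q.complex.linearYonedaObj R N) 0 0 1
    (by simp) (by simp) (preL (resπ Q) N) (preL_resπ Q N)
  have e : (Q.complex.linearYonedaObj R N).homology 0 ≃ₗ[R] ExtMod R 0 M N :=
    (Q.isoExt (R := R) 0 N).symm.toLinearEquiv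
  refine ⟨(LinearEquiv.ofBijective φ ⟨?_, h1⟩).trans e⟩
  rw [← LinearMap.ker_eq_bot, LinearMap.ker_eq_bot']
  intro v hv
  obtain ⟨y, hy⟩ := (h2 v).1 hv
  rw [(Q.complex.linearYonedaObj R N).shape 0 0 (by simp)] at hy
  have h3 : resπ Q ≫ ModuleCat.ofHom v = 0 := hy.symm
  have : ModuleCat.ofHom v = 0 := (cancel_epi (resπ Q)).1 (by rw [h3, comp_zero])
  exact congrArg ModuleCat.Hom.hom this

lemma extMod_one_pres (S : ShortComplex (ModuleCat.{u} R)) (hS : S.ShortExact) [Projective S.X₂]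
    (N : ModuleCat.{u} R) :
    ∃ φ : (S.X₁ →ₗ[R] N) →ₗ[R] ExtMod R 1 S.X₃ N, Function.Surjective φ ∧
      ∀ v, φ v = 0 ↔ ∃ y : S.X₂ →ₗ[R] N, y ∘ₗ S.f.hom = v := by
  let Q := ProjectiveResolution.of S.X₁
  obtain ⟨φ, h1, h2⟩ := cochain_homology_pres ((augRes S hS Q).complex.linearYonedaObj R N) 0 1 2
    (by simp) (by simp) (preL (resπ Q) N) (preL_resπ Q N)
  let e : ((augRes S hS Q).complex.linearYonedaObj R N).homology 1 ≃ₗ[R] ExtMod R 1 S.X₃ N :=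
    ((augRes S hS Q).isoExt (R := R) 1 N).symm.toLinearEquiv
  refine ⟨e.toLinearMap ∘ₗ φ, e.surjective.comp h1, fun v => ?_⟩
  have : (e.toLinearMap ∘ₗ φ) v = 0 ↔ φ v = 0 := by simp
  rw [this, h2]
  constructor
  · rintro ⟨y, hy⟩
    have hy' : (resπ Q ≫ S.f) ≫ (show S.X₂ ⟶ N from y) = resπ Q ≫ ModuleCat.ofHom v := hy
    rw [Category.assoc, cancel_epi] at hy'
    exact ⟨(show S.X₂ ⟶ N from y).hom, congrArg ModuleCat.Hom.hom hy'⟩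
  · rintro ⟨y, rfl⟩
    refine ⟨ModuleCat.ofHom y, ?_⟩
    change (resπ Q ≫ S.f) ≫ ModuleCat.ofHom y = resπ Q ≫ _
    rw [Category.assoc]
    rfl

lemma extMod_succ_equiv (S : ShortComplex (ModuleCat.{u} R)) (hS : S.ShortExact) [Projective S.X₂]
    (N : ModuleCat.{u} R) (n : ℕ) :
    Nonempty (ExtMod R (n+2) S.X₃ N ≃ₗ[R] ExtMod R (n+1) S.X₁ N) := by
  let Q := ProjectiveResolution.of S.X₁
  let Q' := augRes S hS Q
  have e1 := ((Q'.complex.linearYonedaObj R N).homologyIsoSc' (n+1) (n+2) (n+3) (by simp) (by simp))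
  have e2 := ((Q.complex.linearYonedaObj R N).homologyIsoSc' n (n+1) (n+2) (by simp) (by simp))
  have e3 : ((Q'.complex.linearYonedaObj R N).sc' (n+1) (n+2) (n+3)).homology ≅
    ((Q.complex.linearYonedaObj R N).sc' n (n+1) (n+2)).homology := Iso.refl _
  exact ⟨(Q'.isoExt (R := R) (n+2) N ≪≫ e1 ≪≫ e3 ≪≫ e2.symm ≪≫
    (Q.isoExt (R := R) (n+1) N).symm).toLinearEquiv⟩

end PartC

section PartD
variable {R}

/-- Vanishing of `Ext`. -/
def EV (n : ℕ) (M N : ModuleCat.{u} R) : Prop := Subsingleton (Abelian.Ext M N n)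

/-- Short exact sequences of linear maps. -/
structure SES {A B C : ModuleCat.{u} R} (f : A →ₗ[R] B) (g : B →ₗ[R] C) : Prop where
  inj : Function.Injective f
  ex : Function.Exact f g
  surj : Function.Surjective g

variable {A B C : ModuleCat.{u} R} {f : A →ₗ[R] B} {g : B →ₗ[R] C}

lemma SES.comp0 (h : SES f g) : g ∘ₗ f = 0 := h.ex.linearMap_comp_eq_zero

/-- the associated short complex -/
abbrev SES.sc (h : SES f g) : ShortComplex (ModuleCat.{u} R) :=
  ShortComplex.mk (ModuleCat.ofHom f) (ModuleCat.ofHom g) (by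
    rw [← ModuleCat.ofHom_comp, h.comp0]; rfl)

lemma SES.se (h : SES f g) : h.sc.ShortExact where
  exact := by
    rw [ShortComplex.ShortExact.moduleCat_exact_iff_function_exact]
    exact h.ex
  mono_f := (ModuleCat.mono_iff_injective _).2 h.inj
  epi_g := (ModuleCat.epi_iff_surjective _).2 h.surj

lemma SES.of_se (S : ShortComplex (ModuleCat.{u} R)) (hS : S.ShortExact) : SES S.f.hom S.g.hom where
  inj := (ModuleCat.mono_iff_injective _).1 hS.mono_f
  ex := (ShortComplex.ShortExact.moduleCat_exact_iff_function_exact _).1 hS.exact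
  surj := (ModuleCat.epi_iff_surjective _).1 hS.epi_g

lemma EV.zero {n : ℕ} {M N : ModuleCat.{u} R} (h : EV n M N) (x : Abelian.Ext M N n) : x = 0 :=
  h.elim _ _

lemma EV.mk {n : ℕ} {M N : ModuleCat.{u} R} (h : ∀ x : Abelian.Ext M N n, x = 0) : EV n M N :=
  ⟨fun x y => (h x).trans (h y).symm⟩

lemma EV.proj {P : ModuleCat.{u} R} [Module.Projective R P] (N : ModuleCat.{u} R) (n : ℕ) :
    EV (n+1) P N := by
  have : Projective P := (IsProjective.iff_projective (P : Type u)).1 inferInstance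
  exact EV.mk fun x => Abelian.Ext.eq_zero_of_projective x

lemma ev_iff (n : ℕ) (M N : ModuleCat.{u} R) : EV (n+1) M N ↔ IsZero (ExtMod R (n+1) M N) :=
  (extMod_isZero_iff_subsingleton M N n).symm

lemma SES.contraC (h : SES f g) {N : ModuleCat.{u} R} {n : ℕ} (hA : EV n A N) (hB : EV (n+1) B N) :
    EV (n+1) C N := EV.mk fun x => by
  obtain ⟨y, hy⟩ := Abelian.Ext.contravariant_sequence_exact₃ h.se N (x : Abelian.Ext h.sc.X₃ N (n+1)) (hB.zero _)
    (n₀ := n) (by omega)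
  rw [← hy, show y = 0 from hA.zero y, Abelian.Ext.comp_zero]

lemma SES.contraB (h : SES f g) {N : ModuleCat.{u} R} {n : ℕ} (hA : EV n A N) (hC : EV n C N) :
    EV n B N := EV.mk fun x => by
  obtain ⟨y, hy⟩ := Abelian.Ext.contravariant_sequence_exact₂ h.se N (x : Abelian.Ext h.sc.X₂ N n) (hA.zero _)
  rw [← hy, show y = 0 from hC.zero y, Abelian.Ext.comp_zero]

lemma SES.contraA (h : SES f g) {N : ModuleCat.{u} R} {n : ℕ} (hB : EV n B N) (hC : EV (n+1) C N) :
    EV n A N := EV.mk fun x => by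
  obtain ⟨y, hy⟩ := Abelian.Ext.contravariant_sequence_exact₁ h.se N (x : Abelian.Ext h.sc.X₁ N n) 
    (n₁ := n+1) (by omega) (hC.zero _)
  rw [← hy, show y = 0 from hB.zero y, Abelian.Ext.comp_zero]

lemma SES.covA (h : SES f g) {N : ModuleCat.{u} R} {n : ℕ} (hC : EV n N C) (hB : EV (n+1) N B) :
    EV (n+1) N A := EV.mk fun x => by
  obtain ⟨y, hy⟩ := Abelian.Ext.covariant_sequence_exact₁ N h.se (x : Abelian.Ext N h.sc.X₁ (n+1)) (hB.zero _)
    (n₀ := n) rfl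
  rw [← hy, show y = 0 from hC.zero y, Abelian.Ext.zero_comp]

lemma SES.covB (h : SES f g) {N : ModuleCat.{u} R} {n : ℕ} (hA : EV n N A) (hC : EV n N C) :
    EV n N B := EV.mk fun x => by
  obtain ⟨y, hy⟩ := Abelian.Ext.covariant_sequence_exact₂ N h.se (x : Abelian.Ext N h.sc.X₂ n) (hC.zero _)
  rw [← hy, show y = 0 from hA.zero y, Abelian.Ext.zero_comp]

lemma SES.covC (h : SES f g) {N : ModuleCat.{u} R} {n : ℕ} (hB : EV n N B) (hA : EV (n+1) N A) :
    EV n N C := EV.mk fun x => by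
  obtain ⟨y, hy⟩ := Abelian.Ext.covariant_sequence_exact₃ N h.se (x : Abelian.Ext N h.sc.X₃ n) 
    rfl (hA.zero _)
  rw [← hy, show y = 0 from hB.zero y, Abelian.Ext.zero_comp]

/-- Maps extend if `Ext¹` vanishes. -/
lemma SES.extend (h : SES f g) {N : ModuleCat.{u} R} (hC : EV 1 C N) (φ : A →ₗ[R] N) :
    ∃ ψ : B →ₗ[R] N, ψ ∘ₗ f = φ := by
  obtain ⟨y, hy⟩ := Abelian.Ext.contravariant_sequence_exact₁ h.se N
    (Abelian.Ext.mk₀ (ModuleCat.ofHom φ) : Abelian.Ext h.sc.X₁ N 0) 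
    (n₁ := 1) (by omega) (hC.zero _)
  obtain ⟨ψ, rfl⟩ := (Abelian.Ext.mk₀_bijective _ _).2 y
  rw [Abelian.Ext.mk₀_comp_mk₀] at hy
  have := (Abelian.Ext.mk₀_bijective _ _).1 hy
  exact ⟨ψ.hom, ModuleCat.hom_ext_iff.1 this⟩

lemma SES.ev_one (h : SES f g) {N : ModuleCat.{u} R} (hB : EV 1 B N)
    (H : ∀ φ : A →ₗ[R] N, ∃ ψ : B →ₗ[R] N, ψ ∘ₗ f = φ) : EV 1 C N := EV.mk fun x => by
  obtain ⟨y, hy⟩ := Abelian.Ext.contravariant_sequence_exact₃ h.se N (x : Abelian.Ext h.sc.X₃ N 1) (hB.zero _)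
    (n₀ := 0) (by omega)
  obtain ⟨φ, rfl⟩ := (Abelian.Ext.mk₀_bijective _ _).2 y
  obtain ⟨ψ, hψ⟩ := H φ.hom
  have : φ = h.sc.f ≫ ModuleCat.ofHom ψ := ModuleCat.hom_ext hψ.symm
  rw [← hy, this, ← Abelian.Ext.mk₀_comp_mk₀, ← Abelian.Ext.comp_assoc (a₁₂ := 1) (a₂₃ := 0) (a := 1) _ _ _ rfl rfl rfl,
    h.se.extClass_comp, Abelian.Ext.zero_comp]

lemma SES.factor (h : SES f g) {N : ModuleCat.{u} R} (φ : B →ₗ[R] N) (hφ : φ ∘ₗ f = 0) :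
    ∃ ψ : C →ₗ[R] N, ψ ∘ₗ g = φ := by
  have : LinearMap.ker g ≤ LinearMap.ker φ := by
    intro x hx
    obtain ⟨a, rfl⟩ := (h.ex x).1 hx
    exact LinearMap.congr_fun hφ a
  refine ⟨(LinearMap.ker g).liftQ φ this ∘ₗ (LinearMap.quotKerEquivOfSurjective g h.surj).symm.toLinearMap, ?_⟩
  ext x
  have : (g.quotKerEquivOfSurjective h.surj).symm (g x) = Submodule.Quotient.mk x := by
    rw [LinearEquiv.symm_apply_eq]; rfl
  simp [this]

end PartD

section PartE

/-- the ring as a module -/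
abbrev RR : ModuleCat.{u} R := ModuleCat.of R R

variable {R}
/-- the dual module -/
abbrev du (M : ModuleCat.{u} R) : ModuleCat.{u} R := ModuleCat.of R (Module.Dual R M)

lemma tr_iff (M : ModuleCat.{u} R) : IsTotallyReflexive R M ↔
    Module.Finite R M ∧ Function.Bijective (Module.Dual.eval R M) ∧
      (∀ n, EV (n+1) M (RR R)) ∧ (∀ n, EV (n+1) (du M) (RR R)) := by
  have key : ∀ X : ModuleCat.{u} R, (∀ i : ℕ, 0 < i → IsZero (ExtMod R i X (RR R))) ↔
      ∀ n, EV (n+1) X (RR R) := by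
    intro X
    constructor
    · intro h n
      exact (ev_iff _ _ _).2 (h _ (by omega))
    · rintro h (_|n) hn
      · omega
      · exact (ev_iff _ _ _).1 (h n)
  unfold IsTotallyReflexive
  rw [key M, key (du M)]

section five
variable {A B C A' B' C' : ModuleCat.{u} R} {f : A →ₗ[R] B} {g : B →ₗ[R] C}
  {f' : A' →ₗ[R] B'} {g' : B' →ₗ[R] C'} {a : A →ₗ[R] A'} {b : B →ₗ[R] B'} {c : C →ₗ[R] C'}

lemma five_mid (h : SES f g) (h' : SES f' g') (h1 : ∀ x, b (f x) = f' (a x)) (h2 : ∀ x, c (g x) = g' (b x))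
    (ha : Function.Bijective a) (hc : Function.Bijective c) : Function.Bijective b := by
  constructor
  · rw [injective_iff_map_eq_zero]
    intro x hx
    have : g x = 0 := hc.1 (by rw [h2, hx]; simp)
    obtain ⟨y, rfl⟩ := (h.ex x).1 this
    rw [h1] at hx
    have : a y = 0 := h'.inj (by rw [hx]; simp)
    have : y = 0 := ha.1 (by rw [this]; simp)
    simp [this]
  · intro x
    obtain ⟨z, hz⟩ := hc.2 (g' x)
    obtain ⟨y, rfl⟩ := h.surj z
    have : g' (x - b y) = 0 := by rw [map_sub, ← h2, hz, sub_self]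
    obtain ⟨w, hw⟩ := (h'.ex _).1 this
    obtain ⟨w, rfl⟩ := ha.2 w
    refine ⟨f w + y, ?_⟩
    rw [map_add, h1, hw]; simp

lemma five_left (h : SES f g) (h' : SES f' g') (h1 : ∀ x, b (f x) = f' (a x)) (h2 : ∀ x, c (g x) = g' (b x))
    (hb : Function.Bijective b) (hc : Function.Injective c) : Function.Bijective a := by
  constructor
  · intro x y hxy
    apply h.inj; apply hb.1; rw [h1, h1, hxy]
  · intro x
    obtain ⟨y, hy⟩ := hb.2 (f' x)
    have : g y = 0 := hc (by rw [h2, hy, (h'.ex _).2 ⟨x, rfl⟩, map_zero])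
    obtain ⟨z, rfl⟩ := (h.ex y).1 this
    exact ⟨z, h'.inj (by rw [← h1, hy])⟩

lemma five_right (h : SES f g) (h' : SES f' g') (h1 : ∀ x, b (f x) = f' (a x)) (h2 : ∀ x, c (g x) = g' (b x))
    (ha : Function.Surjective a) (hb : Function.Bijective b) : Function.Bijective c := by
  constructor
  · rw [injective_iff_map_eq_zero]
    intro x hx
    obtain ⟨y, rfl⟩ := h.surj x
    rw [h2] at hx
    obtain ⟨z, hz⟩ := (h'.ex _).1 hx
    obtain ⟨w, rfl⟩ := ha z
    rw [← h1] at hz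
    rw [← hb.1 hz]
    exact (h.ex _).2 ⟨_, rfl⟩
  · intro x
    obtain ⟨y, rfl⟩ := h'.surj x
    obtain ⟨z, rfl⟩ := hb.2 y
    exact ⟨g z, h2 z⟩
end five

variable {A B C : ModuleCat.{u} R} {f : A →ₗ[R] B} {g : B →ₗ[R] C}

/-- dual map -/
abbrev dm {A B : ModuleCat.{u} R} (f : A →ₗ[R] B) : du B →ₗ[R] du A := f.dualMap

lemma SES.dual' (h : SES f g) (hC : ∀ φ : A →ₗ[R] RR R, ∃ ψ : B →ₗ[R] RR R, ψ ∘ₗ f = φ) : SES (dm g) (dm f) where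
  inj := LinearMap.dualMap_injective_of_surjective h.surj
  surj := fun φ => hC φ
  ex := fun φ => by
    constructor
    · intro hφ
      exact h.factor (N := RR R) φ hφ
    · rintro ⟨ψ, rfl⟩
      show (ψ ∘ₗ g) ∘ₗ f = 0
      rw [LinearMap.comp_assoc, h.comp0, LinearMap.comp_zero]

lemma SES.dual (h : SES f g) (hC : EV 1 C (RR R)) : SES (dm g) (dm f) :=
  h.dual' fun φ => h.extend hC φ

lemma SES.ofEquiv {A B : ModuleCat.{u} R} (e : A ≃ₗ[R] B) :
    SES (A := ModuleCat.of R PUnit) (0 : PUnit.{u+1} →ₗ[R] A) e.toLinearMap where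
  inj := Function.injective_of_subsingleton _
  surj := e.surjective
  ex := fun x => by
    rw [Set.mem_range, LinearEquiv.coe_coe, LinearEquiv.map_eq_zero_iff]
    exact ⟨fun h => ⟨0, h.symm⟩, fun ⟨_, h⟩ => h.symm⟩

lemma finite_of_mono [IsNoetherianRing R] {A B : ModuleCat.{u} R} {f : A →ₗ[R] B} [Module.Finite R B]
    (h : Function.Injective f) : Module.Finite R A := Module.Finite.of_injective f h

lemma SES.finB (h : SES f g) (hA : Module.Finite R A) (hC : Module.Finite R C) : Module.Finite R B := by
  have h2 : Module.Finite R (B ⧸ LinearMap.range f) := by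
    have : LinearMap.range f = LinearMap.ker g := (LinearMap.exact_iff.1 h.ex).symm
    rw [this]
    exact Module.Finite.equiv (LinearMap.quotKerEquivOfSurjective g h.surj).symm
  exact Module.Finite.of_submodule_quotient (LinearMap.range f)

lemma EV.equiv {A B N : ModuleCat.{u} R} (e : A ≃ₗ[R] B) {n : ℕ} (h : EV (n+1) A N) : EV (n+1) B N := by
  refine (SES.ofEquiv e.symm).contraB ?_ h
  have : Module.Projective R (ModuleCat.of R PUnit.{u+1} : ModuleCat.{u} R) := inferInstanceAs (Module.Projective R PUnit.{u+1})
  exact EV.proj _ _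

lemma tr_proj [IsNoetherianRing R] (P : ModuleCat.{u} R) [Module.Finite R P] [Module.Projective R P] : IsTotallyReflexive R P := by
  rw [tr_iff]
  refine ⟨inferInstance, Module.bijective_dual_eval R P, fun n => EV.proj _ _, fun n => ?_⟩
  have : Module.Projective R (du P) := inferInstanceAs (Module.Projective R (Module.Dual R P))
  exact EV.proj _ _

lemma tr_mid (h : SES f g) (hA : IsTotallyReflexive R A) (hC : IsTotallyReflexive R C) :
    IsTotallyReflexive R B := by
  rw [tr_iff] at *
  obtain ⟨a1, a2, a3, a4⟩ := hA
  obtain ⟨c1, c2, c3, c4⟩ := hC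
  have hd := h.dual (c3 0)
  have hdd := hd.dual (a4 0)
  refine ⟨h.finB a1 c1, ?_, fun n => h.contraB (a3 n) (c3 n), fun n => hd.contraB (c4 n) (a4 n)⟩
  exact five_mid h hdd (a := Module.Dual.eval R A) (b := Module.Dual.eval R B) (c := Module.Dual.eval R C) 
    (fun x => rfl) (fun x => rfl) a2 c2

lemma tr_left [IsNoetherianRing R] (h : SES f g) (hB : IsTotallyReflexive R B) (hC : IsTotallyReflexive R C) :
    IsTotallyReflexive R A := by
  rw [tr_iff] at *
  obtain ⟨a1, a2, a3, a4⟩ := hB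
  obtain ⟨c1, c2, c3, c4⟩ := hC
  have hd := h.dual (c3 0)
  have hx : ∀ φ : du C →ₗ[R] RR R, ∃ ψ : du B →ₗ[R] RR R, ψ ∘ₗ (dm g) = φ := by
    intro φ
    obtain ⟨c, rfl⟩ := c2.2 φ
    obtain ⟨b, rfl⟩ := h.surj c
    exact ⟨Module.Dual.eval R B b, rfl⟩
  have hdd := hd.dual' hx
  refine ⟨finite_of_mono h.inj, ?_, fun n => h.contraA (a3 n) (c3 (n+1)), ?_⟩
  · exact five_left h hdd (a := Module.Dual.eval R A) (b := Module.Dual.eval R B) (c := Module.Dual.eval R C) 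
      (fun x => rfl) (fun x => rfl) a2 c2.1
  · rintro (_|n)
    · exact hd.ev_one (a4 0) hx
    · exact hd.contraC (c4 n) (a4 (n+1))

lemma tr_right (h : SES f g) (hA : IsTotallyReflexive R A) (hB : IsTotallyReflexive R B)
    (hC : EV 1 C (RR R)) : IsTotallyReflexive R C := by
  rw [tr_iff] at *
  obtain ⟨a1, a2, a3, a4⟩ := hA
  obtain ⟨c1, c2, c3, c4⟩ := hB
  have hd := h.dual hC
  have hdd := hd.dual (a4 0)
  refine ⟨Module.Finite.of_surjective g h.surj, ?_, ?_, fun n => hd.contraA (c4 n) (a4 (n+1))⟩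
  · exact five_right h hdd (a := Module.Dual.eval R A) (b := Module.Dual.eval R B) (c := Module.Dual.eval R C) 
      (fun x => rfl) (fun x => rfl) a2.2 c2
  · rintro (_|n)
    · exact hC
    · exact h.contraC (a3 n) (c3 (n+1))

lemma tr_zero [IsNoetherianRing R] : IsTotallyReflexive R (ModuleCat.of R PUnit.{u+1}) := by
  have h1 : Module.Projective R (ModuleCat.of R PUnit.{u+1} : ModuleCat.{u} R) := inferInstanceAs (Module.Projective R PUnit.{u+1})
  have h2 : Module.Finite R (ModuleCat.of R PUnit.{u+1} : ModuleCat.{u} R) := inferInstanceAs (Module.Finite R PUnit.{u+1})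
  exact tr_proj _

lemma tr_equiv [IsNoetherianRing R] (e : A ≃ₗ[R] B) (h : IsTotallyReflexive R A) : IsTotallyReflexive R B :=
  tr_mid (SES.ofEquiv e.symm) tr_zero h

lemma fin_du [IsNoetherianRing R] (A : ModuleCat.{u} R) [Module.Finite R A] : Module.Finite R (du A) := by
  obtain ⟨n, g, hg⟩ := Module.Finite.exists_fin' R A
  exact Module.Finite.of_injective g.dualMap (LinearMap.dualMap_injective_of_surjective hg)

lemma tr_du [IsNoetherianRing R] (h : IsTotallyReflexive R A) : IsTotallyReflexive R (du A) := by
  rw [tr_iff] at *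
  obtain ⟨a1, a2, a3, a4⟩ := h
  have hf := fin_du A
  refine ⟨hf, ?_, a4, fun n => ?_⟩
  · let e := LinearEquiv.ofBijective _ a2
    have : Module.Dual.eval R (du A) = e.symm.dualMap.toLinearMap := by
      apply LinearMap.ext; intro φ
      apply LinearMap.ext; intro x
      obtain ⟨y, rfl⟩ := e.surjective x
      simp [e]
    rw [this]
    exact e.symm.dualMap.bijective
  · exact EV.equiv (A := A) (B := du (du A)) (LinearEquiv.ofBijective _ a2) (a3 n)

/-- `A` is a first syzygy of `B` -/
def Step (A B : ModuleCat.{u} R) : Prop :=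
  ∃ (P : ModuleCat.{u} R) (_ : Module.Finite R P) (_ : Module.Projective R P) (f : A →ₗ[R] P) (g : P →ₗ[R] B),
    SES f g

lemma ses_ker (g : B →ₗ[R] C) (hg : Function.Surjective g) :
    SES (A := ModuleCat.of R (LinearMap.ker g)) (LinearMap.ker g).subtype g where
  inj := Subtype.val_injective
  surj := hg
  ex := LinearMap.exact_subtype_ker_map g

lemma exists_cover [IsNoetherianRing R] (M : ModuleCat.{u} R) [Module.Finite R M] :
    ∃ (K : ModuleCat.{u} R), Module.Finite R K ∧ Step K M := by
  obtain ⟨n, g, hg⟩ := Module.Finite.exists_fin' R M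
  refine ⟨ModuleCat.of R (LinearMap.ker g), inferInstanceAs (Module.Finite R (LinearMap.ker g)), 
    ModuleCat.of R (Fin n → R), inferInstanceAs (Module.Finite R (Fin n → R)), 
    inferInstanceAs (Module.Projective R (Fin n → R)), _, g, ses_ker (B := ModuleCat.of R (Fin n → R)) g hg⟩

lemma tr_syz [IsNoetherianRing R] {A B : ModuleCat.{u} R} (hs : Step A B) (h : IsTotallyReflexive R B) :
    IsTotallyReflexive R A := by
  obtain ⟨P, _, _, f, g, hS⟩ := hs
  exact tr_left hS (tr_proj P) h

lemma exists_syz [IsNoetherianRing R] {B : ModuleCat.{u} R} (h : IsTotallyReflexive R B) :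
    ∃ A, IsTotallyReflexive R A ∧ Step A B := by
  have := h.1
  obtain ⟨K, _, hs⟩ := exists_cover B
  exact ⟨K, tr_syz hs h, hs⟩

lemma exists_cosyz [IsNoetherianRing R] {A : ModuleCat.{u} R} (h : IsTotallyReflexive R A) :
    ∃ B, IsTotallyReflexive R B ∧ Step A B := by
  obtain ⟨L, hL, P, _, _, f, g, hS⟩ := exists_syz (tr_du h)
  have hd := hS.dual (((tr_iff _).1 (tr_du h)).2.2.1 0)
  have hb := h.2.1
  refine ⟨du L, tr_du hL, du P, inferInstanceAs (Module.Finite R (Module.Dual R P)), 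
    inferInstanceAs (Module.Projective R (Module.Dual R P)), dm g ∘ₗ Module.Dual.eval R A, dm f, ?_, ?_, ?_⟩
  · exact hd.inj.comp hb.1
  · intro x
    rw [hd.ex x]
    constructor
    · rintro ⟨y, rfl⟩
      obtain ⟨z, rfl⟩ := hb.2 y
      exact ⟨z, rfl⟩
    · rintro ⟨y, rfl⟩
      exact ⟨_, rfl⟩
  · exact hd.surj

end PartE

section PartF
variable {R}

/-- iterated syzygy form of G-dimension at most `n` -/
def GD : ℕ → ModuleCat.{u} R → Prop
  | 0, M => IsTotallyReflexive R M
  | n+1, M => ∃ K, GD n K ∧ Step K M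

variable {A B C : ModuleCat.{u} R} {f : A →ₗ[R] B} {g : B →ₗ[R] C}

lemma SES.lift (h : SES f g) {X : ModuleCat.{u} R} (φ : X →ₗ[R] B) (hφ : ∀ x, g (φ x) = 0) :
    ∃ ψ : X →ₗ[R] A, ∀ x, f (ψ x) = φ x := by
  let e := LinearEquiv.ofInjective f h.inj
  have hr : ∀ x, φ x ∈ LinearMap.range f := fun x => (h.ex _).1 (hφ x)
  refine ⟨e.symm.toLinearMap ∘ₗ φ.codRestrict _ hr, fun x => ?_⟩
  have : e (e.symm (φ.codRestrict _ hr x)) = φ.codRestrict _ hr x := e.apply_symm_apply _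
  exact congrArg Subtype.val this

variable [IsNoetherianRing R]

lemma gd_horse (n : ℕ) : ∀ {A B C : ModuleCat.{u} R} {f : A →ₗ[R] B} {g : B →ₗ[R] C}, SES f g →
    IsTotallyReflexive R A → GD n C → GD n B := by
  induction n with
  | zero => intro A B C f g h hA hC; exact tr_mid h hA hC
  | succ n ih =>
    rintro A B C f g h hA ⟨K, hK, P, _, _, i, p, hP⟩
    obtain ⟨A1, hA1, Q, _, _, j, q, hQ⟩ := exists_syz hA
    obtain ⟨l, hl⟩ := Module.projective_lifting_property g p h.surj
    let H : Q × P →ₗ[R] B := (f ∘ₗ q).coprod l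
    have hH : Function.Surjective H := by
      intro b
      obtain ⟨x, hx⟩ := hP.surj (g b)
      have : g (b - l x) = 0 := by
        rw [map_sub, ← LinearMap.comp_apply g l, hl, hx, sub_self]
      obtain ⟨a, ha⟩ := (h.ex _).1 this
      obtain ⟨y, rfl⟩ := hQ.surj a
      exact ⟨(y, x), by simp [H, ha]⟩
    let QP : ModuleCat.{u} R := ModuleCat.of R (Q × P)
    let H' : QP →ₗ[R] B := H
    let B1 : ModuleCat.{u} R := ModuleCat.of R (LinearMap.ker H')
    refine ⟨B1, ?_, QP, inferInstanceAs (Module.Finite R (Q × P)), inferInstanceAs (Module.Projective R (Q × P)), 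
      _, H', ses_ker H' hH⟩
    have hgf : ∀ a, g (f a) = 0 := fun a => (h.ex _).2 ⟨a, rfl⟩
    have hpz : ∀ x : B1, p (x.1.2) = 0 := by
      rintro ⟨⟨y, x⟩, hx⟩
      have h1 : f (q y) + l x = 0 := hx
      have h2 : g (f (q y) + l x) = 0 := by rw [h1, map_zero]
      rw [map_add, hgf, zero_add] at h2
      exact (LinearMap.congr_fun hl x).symm.trans h2
    obtain ⟨ψ, hψ⟩ := hP.lift (X := B1) (LinearMap.snd R Q P ∘ₗ (LinearMap.ker H').subtype) hpz
    have hjz : ∀ a, (LinearMap.inl R Q P ∘ₗ j) a ∈ LinearMap.ker H' := by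
      intro a
      have : q (j a) = 0 := (hQ.ex _).2 ⟨a, rfl⟩
      simp [H', H, this]
    let j' : A1 →ₗ[R] B1 := (LinearMap.inl R Q P ∘ₗ j).codRestrict _ hjz
    have hj' : ∀ a, (j' a).1 = (j a, 0) := fun a => rfl
    refine ih (f := j') (g := ψ) ⟨?_, ?_, ?_⟩ hA1 hK
    · intro a b hab
      have := congrArg (fun z => z.1.1) hab
      exact hQ.inj this
    · intro x
      constructor
      · intro hx
        have h1 : x.1.2 = 0 := by
          have := hψ x
          rw [hx, map_zero] at this
          exact this.symm
        have h2 : f (q x.1.1) + l x.1.2 = 0 := x.2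
        rw [h1, map_zero, add_zero] at h2
        have h3 : q x.1.1 = 0 := h.inj (by rw [h2, map_zero])
        obtain ⟨a, ha⟩ := (hQ.ex _).1 h3
        exact ⟨a, Subtype.ext (Prod.ext ha h1.symm)⟩
      · rintro ⟨a, rfl⟩
        apply hP.inj
        rw [hψ, map_zero]
        rfl
    · intro k
      have h1 : g (l (i k)) = 0 := by
        have := LinearMap.congr_fun hl (i k)
        exact this.trans ((hP.ex _).2 ⟨k, rfl⟩)
      obtain ⟨a, ha⟩ := (h.ex _).1 h1
      obtain ⟨y, hy⟩ := hQ.surj a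
      have hm : ((-y, i k) : Q × P) ∈ LinearMap.ker H' := by
        simp [H', H, hy, ha]
      refine ⟨⟨(-y, i k), hm⟩, hP.inj ?_⟩
      rw [hψ]
      rfl

lemma gd_succ {n : ℕ} (h : SES f g) (hB : IsTotallyReflexive R B) (hA : GD n A) : GD (n+1) C := by
  obtain ⟨G1, hG1, Q, _, _, j, q, hQ⟩ := exists_syz hB
  have hs : Function.Surjective (g ∘ₗ q) := h.surj.comp hQ.surj
  refine ⟨ModuleCat.of R (LinearMap.ker (g ∘ₗ q)), ?_, Q, ‹_›, ‹_›, _, _, ses_ker _ hs⟩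
  obtain ⟨ψ, hψ⟩ := h.lift (X := ModuleCat.of R (LinearMap.ker (g ∘ₗ q)))
    (q ∘ₗ (LinearMap.ker (g ∘ₗ q)).subtype) (fun x => x.2)
  have hjz : ∀ a, j a ∈ LinearMap.ker (g ∘ₗ q) := by
    intro a
    have : q (j a) = 0 := (hQ.ex _).2 ⟨a, rfl⟩
    simp [this]
  refine gd_horse n (f := (j.codRestrict _ hjz : G1 →ₗ[R] ModuleCat.of R (LinearMap.ker (g ∘ₗ q)))) (g := ψ) ⟨?_, ?_, ?_⟩ hG1 hA
  · intro a b hab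
    exact hQ.inj (congrArg Subtype.val hab)
  · intro x
    constructor
    · intro hx
      have h1 := hψ x
      rw [hx, map_zero] at h1
      obtain ⟨a, ha⟩ := (hQ.ex x.1).1 h1.symm
      exact ⟨a, Subtype.ext ha⟩
    · rintro ⟨a, rfl⟩
      apply h.inj
      rw [hψ, map_zero]
      exact (hQ.ex _).2 ⟨a, rfl⟩
  · intro k
    obtain ⟨y, hy⟩ := hQ.surj (f k)
    have hm : y ∈ LinearMap.ker (g ∘ₗ q) := by
      simpa [hy] using (h.ex _).2 ⟨k, rfl⟩
    refine ⟨⟨y, hm⟩, h.inj ?_⟩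
    rw [hψ]
    exact hy

lemma gd_down (n : ℕ) : ∀ {M : ModuleCat.{u} R}, GD (n+1) M → EV (n+1) M (RR R) → GD n M := by
  induction n with
  | zero =>
    rintro M ⟨K, hK, P, _, _, i, p, hP⟩ hE
    exact tr_right hP hK (tr_proj P) hE
  | succ n ih =>
    rintro M ⟨K, hK, P, _, _, i, p, hP⟩ hE
    exact ⟨K, ih hK (hP.contraA (EV.proj _ _) hE), P, ‹_›, ‹_›, i, p, hP⟩

end PartF

section PartG
set_option linter.unusedSectionVars false
variable {R}
variable [IsNoetherianRing R]

/-- totally reflexive resolutions with `m` nonzero terms -/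
def ResLE (M : ModuleCat.{u} R) (m : ℕ) : Prop :=
  ∃ (G : ChainComplex (ModuleCat.{u} R) ℕ) (ε : G.X 0 ⟶ M),
    (∀ i, i < m → IsTotallyReflexive R (G.X i)) ∧
    (∀ i, m ≤ i → IsZero (G.X i)) ∧
    Epi ε ∧
    (∃ w : G.d 1 0 ≫ ε = 0, (ShortComplex.mk (G.d 1 0) ε w).Exact) ∧
    (∀ i, 0 < i → G.ExactAt i)

lemma gdimLE_iff (M : ModuleCat.{u} R) (n : ℕ) : GDimLE R M n ↔ ResLE M (n+1) := by
  unfold GDimLE ResLE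
  simp only [Order.lt_add_one_iff, Order.add_one_le_iff]

lemma resLE_zero : ResLE (ModuleCat.of R PUnit.{u+1}) 0 := by
  have hz : IsZero (ModuleCat.of R PUnit.{u+1}) := ModuleCat.isZero_of_subsingleton _
  let Z : ChainComplex (ModuleCat.{u} R) ℕ := { X := fun _ => ModuleCat.of R PUnit.{u+1}, d := fun _ _ => 0 }
  refine ⟨Z, 0, ?_, fun i _ => hz, ⟨fun _ _ _ => hz.eq_of_src _ _⟩, ⟨by simp, ?_⟩, ?_⟩
  · intro i hi; omega
  · apply ShortComplex.exact_of_isZero_X₂; exact hz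
  · intro i hi
    rw [HomologicalComplex.exactAt_iff]
    apply ShortComplex.exact_of_isZero_X₂; exact hz

lemma resLE_succ {A B C : ModuleCat.{u} R} {f : A →ₗ[R] B} {g : B →ₗ[R] C} (h : SES f g) 
    (hB : IsTotallyReflexive R B) {m : ℕ} (hA : ResLE A m) : ResLE C (m+1) := by
  obtain ⟨X, e, h1, h2, h3, ⟨w, h4⟩, h5⟩ := hA
  have w' : X.d 1 0 ≫ e ≫ h.sc.f = 0 := by rw [← Category.assoc, w, zero_comp]
  have w2 : (e ≫ h.sc.f) ≫ h.sc.g = 0 := by rw [Category.assoc, h.sc.zero, comp_zero]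
  refine ⟨X.augment (e ≫ h.sc.f) w', h.sc.g, ?_, ?_, h.se.epi_g, ⟨w2, ?_⟩, ?_⟩
  · rintro (_|i) hi
    · exact hB
    · exact h1 i (by omega)
  · rintro (_|i) hi
    · omega
    · exact h2 i (by omega)
  · exact aug_exact0 h.sc h.se e w2
  · rintro (_|i) hi
    · omega
    · exact aug_exactAt h.sc h.se X e w w' h4 (fun n => h5 _ (by omega)) i

lemma gd_resLE (n : ℕ) : ∀ {M : ModuleCat.{u} R}, GD n M → ResLE M (n+1) := by
  induction n with
  | zero => 
    intro M hM
    exact resLE_succ (SES.ofEquiv (LinearEquiv.refl R M)) hM resLE_zero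
  | succ n ih =>
    rintro M ⟨K, hK, P, _, _, i, p, hP⟩
    exact resLE_succ hP (tr_proj P) (ih hK)

lemma resLE_gd (n : ℕ) : ∀ {M : ModuleCat.{u} R}, ResLE M (n+1) → GD n M := by
  induction n with
  | zero =>
    rintro M ⟨X, e, h1, h2, h3, ⟨w, h4⟩, h5⟩
    have hs : Function.Surjective e.hom := (ModuleCat.epi_iff_surjective e).1 h3
    have hm : Mono e := (ShortComplex.exact_iff_mono _ ((h2 1 le_rfl).eq_of_src _ _)).1 h4
    have hi : Function.Injective e.hom := (ModuleCat.mono_iff_injective e).1 hm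
    exact tr_equiv (LinearEquiv.ofBijective e.hom ⟨hi, hs⟩) (h1 0 (by omega))
  | succ n ih =>
    rintro M ⟨X, e, h1, h2, h3, ⟨w, h4⟩, h5⟩
    have hs : Function.Surjective e.hom := (ModuleCat.epi_iff_surjective e).1 h3
    have hS := ses_ker e.hom hs
    refine gd_succ hS (h1 0 (by omega)) (ih ?_)
    have h4' := (ShortComplex.ShortExact.moduleCat_exact_iff_function_exact _).1 h4
    have hr : ∀ x, (X.d 1 0).hom x ∈ LinearMap.ker e.hom := fun x => (h4' _).2 ⟨x, rfl⟩
    let ε : X.X 1 ⟶ ModuleCat.of R (LinearMap.ker e.hom) := ModuleCat.ofHom ((X.d 1 0).hom.codRestrict _ hr)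
    have hε : ε ≫ ModuleCat.ofHom (LinearMap.ker e.hom).subtype = X.d 1 0 := rfl
    have hmono : Mono (ModuleCat.ofHom (LinearMap.ker e.hom).subtype) := hS.se.mono_f
    have hw : X.d 2 1 ≫ ε = 0 := by
      rw [← cancel_mono (ModuleCat.ofHom (LinearMap.ker e.hom).subtype), Category.assoc, hε]; simp
    have h51 := (HomologicalComplex.exactAt_iff' _ 2 1 0 (by simp) (by simp)).1 (h5 1 (by omega))
    refine ⟨ChainComplex.truncate.obj X, ε, fun i hi => h1 (i+1) (by omega), fun i hi => h2 (i+1) (by omega), ?_, ⟨hw, ?_⟩, ?_⟩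
    · apply (ModuleCat.epi_iff_surjective _).2
      rintro ⟨x, hx⟩
      obtain ⟨y, hy⟩ := (h4' _).1 hx
      exact ⟨y, Subtype.ext hy⟩
    · rw [ShortComplex.moduleCat_exact_iff] at h51 ⊢
      intro x hx
      refine h51 x ?_
      exact congrArg Subtype.val hx
    · rintro (_|i) hi
      · omega
      · have := (HomologicalComplex.exactAt_iff' _ (i+3) (i+2) (i+1) (by simp) (by simp)).1 (h5 (i+2) (by omega))
        rw [HomologicalComplex.exactAt_iff' _ (i+2) (i+1) i (by simp) (by simp)]
        exact this

lemma gdim_gd {M : ModuleCat.{u} R} {g : ℕ} (hg : gdim R M = (g : ℕ∞)) :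
    GD g M ∧ ∀ n, g = n + 1 → ¬ EV (n+1) M (RR R) := by
  have hne : {c : ℕ∞ | ∃ n : ℕ, c = n ∧ GDimLE R M n}.Nonempty := by
    by_contra h
    rw [Set.not_nonempty_iff_eq_empty] at h
    unfold gdim at hg
    rw [h, sInf_empty] at hg
    exact ENat.top_ne_natCast _ hg
  have hmem := csInf_mem hne
  obtain ⟨n, hn, hG⟩ := hmem
  have hgn : g = n := by
    have : (g : ℕ∞) = n := hg.symm.trans hn
    exact_mod_cast this
  subst hgn
  have hgd := resLE_gd _ ((gdimLE_iff _ _).1 hG)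
  refine ⟨hgd, ?_⟩
  rintro n rfl hE
  have h2 := (gdimLE_iff _ _).2 (gd_resLE _ (gd_down n hgd hE))
  have : gdim R M ≤ (n : ℕ∞) := csInf_le (OrderBot.bddBelow _) ⟨n, rfl, h2⟩
  rw [hg] at this
  have : n + 1 ≤ n := by exact_mod_cast this
  omega

end PartG

section PartH
set_option linter.unusedSectionVars false
variable {R}
variable [IsNoetherianRing R]

/-- extension by zero of a nonnegative complex: objects -/
def posX (Q : ChainComplex (ModuleCat.{u} R) ℕ) : ℤ → ModuleCat.{u} R
  | Int.ofNat n => Q.X n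
  | Int.negSucc _ => ModuleCat.of R PUnit.{u+1}

/-- extension by zero of a nonnegative complex: differentials -/
def posD (Q : ChainComplex (ModuleCat.{u} R) ℕ) : ∀ i : ℤ, posX Q (i + 1) ⟶ posX Q i
  | Int.ofNat n => Q.d (n+1) n
  | Int.negSucc _ => 0

/-- extension by zero of a nonnegative complex -/
def pos (Q : ChainComplex (ModuleCat.{u} R) ℕ) : ChainComplex (ModuleCat.{u} R) ℤ :=
  ChainComplex.of (posX Q) (posD Q) (by
    rintro (n|n)
    · exact Q.d_comp_d _ _ _
    · exact comp_zero)

lemma pos_d (Q : ChainComplex (ModuleCat.{u} R) ℕ) (i : ℤ) : (pos Q).d (i+1) i = posD Q i :=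
  ChainComplex.of_d _ _ _

/-- chain maps to an extension by zero: components -/
def posHomF (T : ChainComplex (ModuleCat.{u} R) ℤ) (Q : ChainComplex (ModuleCat.{u} R) ℕ)
    (φ : ∀ n : ℕ, T.X (n : ℤ) ⟶ Q.X n) : ∀ i : ℤ, T.X i ⟶ posX Q i
  | Int.ofNat n => φ n
  | Int.negSucc _ => 0

/-- chain maps to an extension by zero -/
def posHom (T : ChainComplex (ModuleCat.{u} R) ℤ) (Q : ChainComplex (ModuleCat.{u} R) ℕ)
    (φ : ∀ n : ℕ, T.X (n : ℤ) ⟶ Q.X n) (hφ : ∀ n : ℕ, T.d ((n+1 : ℕ) : ℤ) n ≫ φ n = φ (n+1) ≫ Q.d (n+1) n) :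
    T ⟶ pos Q where
  f := posHomF T Q φ
  comm' := by
    intro i j hij
    have hij : j + 1 = i := hij
    subst hij
    rw [pos_d]
    rcases j with (n|n)
    · exact (hφ n).symm
    · exact (ModuleCat.isZero_of_subsingleton (ModuleCat.of R PUnit.{u+1})).eq_of_tgt _ _

/-- restriction to nonnegative degrees -/
def res (T : ChainComplex (ModuleCat.{u} R) ℤ) : ChainComplex (ModuleCat.{u} R) ℕ where
  X n := T.X n
  d i j := T.d i j
  shape i j h := T.shape _ _ (by
    intro h'; apply h
    have : (j : ℤ) + 1 = i := h'
    show j + 1 = i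
    exact_mod_cast this)
  d_comp_d' i j k _ _ := T.d_comp_d _ _ _

/-- complete resolutions from elementary data -/
def mkCR {M : ModuleCat.{u} R} (T : ChainComplex (ModuleCat.{u} R) ℤ) (Q : ChainComplex (ModuleCat.{u} R) ℕ)
    (φ : ∀ n : ℕ, T.X (n : ℤ) ⟶ Q.X n) (hφ : ∀ n : ℕ, T.d ((n+1 : ℕ) : ℤ) n ≫ φ n = φ (n+1) ≫ Q.d (n+1) n)
    (ε : Q.X 0 ⟶ M) (pT : ∀ i, Projective (T.X i)) (fT : ∀ i, Module.Finite R (T.X i))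
    (pQ : ∀ i, Projective (Q.X i)) (fQ : ∀ i, Module.Finite R (Q.X i)) (hε : Epi ε)
    (w : Q.d 1 0 ≫ ε = 0) (hex : (ShortComplex.mk (Q.d 1 0) ε w).Exact)
    (hQ : ∀ n, Q.ExactAt (n+1)) (exT : ∀ i, T.ExactAt i) 
    (exTd : ∀ i : ℤ, (T.linearYonedaObj R (RR R)).ExactAt i) (n₀ : ℕ) (hn₀ : ∀ n, n₀ ≤ n → IsIso (φ n)) :
    CompleteResolution R M where
  T := T
  P := pos Q
  θ := posHom T Q φ hφ
  π := ε
  projT := pT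
  fgT := fT
  projP := by
    rintro (n|n)
    · exact pQ n
    · exact (ModuleCat.isZero_of_subsingleton (ModuleCat.of R PUnit.{u+1})).projective
  fgP := by
    rintro (n|n)
    · exact fQ n
    · exact inferInstanceAs (Module.Finite R PUnit.{u+1})
  zeroP := by
    rintro (n|n) hn
    · exact absurd hn (by simp)
    · exact (ModuleCat.isZero_of_subsingleton (ModuleCat.of R PUnit.{u+1}))
  epiπ := hε
  wπ := by
    have := pos_d Q 0
    rw [show (pos Q).d 1 0 = Q.d 1 0 from this]
    exact w
  exact0 := by
    have := pos_d Q 0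
    have h2 : (pos Q).d 1 0 = Q.d 1 0 := this
    rw [ShortComplex.moduleCat_exact_iff] at hex ⊢
    intro x hx
    obtain ⟨y, hy⟩ := hex x hx
    refine ⟨y, ?_⟩
    have : (pos Q).d 1 0 y = x := by rw [h2]; exact hy
    exact this
  exactP := by
    intro i hi
    obtain ⟨n, rfl⟩ : ∃ n : ℕ, i = Int.ofNat n + 1 := ⟨(i-1).toNat, by simp; omega⟩
    rw [HomologicalComplex.exactAt_iff' _ (Int.ofNat n + 1 + 1) (Int.ofNat n + 1) (Int.ofNat n) (by simp) (by simp)]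
    have := hQ n
    rw [HomologicalComplex.exactAt_iff' _ (n + 1 + 1) (n + 1) n (by simp) (by simp)] at this
    have h1 : (pos Q).d (Int.ofNat n + 1 + 1) (Int.ofNat n + 1) = Q.d (n+2) (n+1) := pos_d Q (Int.ofNat n + 1)
    have h2 : (pos Q).d (Int.ofNat n + 1) (Int.ofNat n) = Q.d (n+1) n := pos_d Q (Int.ofNat n)
    rw [ShortComplex.moduleCat_exact_iff] at this ⊢
    intro x hx
    obtain ⟨y, hy⟩ := this x (by
      have hx : (pos Q).d (Int.ofNat n + 1) (Int.ofNat n) x = 0 := hx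
      rw [h2] at hx; exact hx)
    refine ⟨y, ?_⟩
    have : (pos Q).d (Int.ofNat n + 1 + 1) (Int.ofNat n + 1) y = x := by
      rw [h1]; exact hy
    exact this
  exactT := exT
  exactTdual := exTd
  iso_eventually := by
    refine ⟨n₀, ?_⟩
    rintro (n|n) hn
    · exact hn₀ n (by simpa using hn)
    · exact absurd hn (by omega)

end PartH

section PartI
set_option linter.unusedSectionVars false
variable {R}
variable [IsNoetherianRing R]

lemma lift_to_proj (T : ChainComplex (ModuleCat.{u} R) ℤ)
    (exTd : ∀ i : ℤ, (T.linearYonedaObj R (RR R)).ExactAt i) (P : ModuleCat.{u} R)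
    [Module.Finite R P] [Module.Projective R P] (i j k : ℤ) (hij : i + 1 = j) (hjk : j + 1 = k)
    (f : T.X j ⟶ P) (hf : T.d k j ≫ f = 0) : ∃ h : T.X i ⟶ P, T.d j i ≫ h = f := by
  obtain ⟨n, p, q, hp, hq, hpq⟩ := Module.Finite.exists_comp_eq_id_of_projective R P
  have key := (lyo_exactAt_iff T (RR R) i j k hij hjk).1 (exTd j)
  have : ∀ a : Fin n, ∃ h : T.X i ⟶ RR R, T.d j i ≫ h = 
      f ≫ ModuleCat.ofHom ((LinearMap.proj a : (Fin n → R) →ₗ[R] R) ∘ₗ q) := by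
    intro a
    apply key
    rw [← Category.assoc, hf, zero_comp]
  choose h hh using this
  refine ⟨ModuleCat.ofHom (p ∘ₗ LinearMap.pi (fun a => (h a).hom)), ?_⟩
  ext x
  have h1 : (LinearMap.pi (fun a => (h a).hom)) (T.d j i x) = q (f x) := by
    funext a
    exact LinearMap.congr_fun (ModuleCat.hom_ext_iff.1 (hh a)) x
  have h2 : p (q (f x)) = f x := LinearMap.congr_fun hpq (f x)
  have h3 : p ((LinearMap.pi (fun a => (h a).hom)) (T.d j i x)) = f x := by rw [h1, h2]
  exact h3

/-- shifted complex -/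
def shT (T : ChainComplex (ModuleCat.{u} R) ℤ) : ChainComplex (ModuleCat.{u} R) ℤ where
  X i := T.X (i - 1)
  d i j := T.d (i-1) (j-1)
  shape i j h := T.shape _ _ (by
    intro h'; apply h
    have : (j - 1) + 1 = i - 1 := h'
    show j + 1 = i
    omega)
  d_comp_d' i j k _ _ := T.d_comp_d _ _ _

lemma shT_exact (T : ChainComplex (ModuleCat.{u} R) ℤ) (i : ℤ) (h : T.ExactAt (i-1)) : (shT T).ExactAt i := by
  rw [HomologicalComplex.exactAt_iff' _ (i+1) i (i-1) (by simp) (by simp)]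
  rw [HomologicalComplex.exactAt_iff' _ (i+1-1) (i-1) (i-1-1) (by simp) (by simp)] at h
  exact h

lemma shT_lyo (T : ChainComplex (ModuleCat.{u} R) ℤ) (N : ModuleCat.{u} R) (i : ℤ) :
    (T.linearYonedaObj R N).ExactAt (i-1) ↔ ((shT T).linearYonedaObj R N).ExactAt i := by
  rw [lyo_exactAt_iff T N (i-1-1) (i-1) (i+1-1) (by omega) (by omega)]
  rw [lyo_exactAt_iff (shT T) N (i-1) i (i+1) (by omega) (by omega)]
  rfl

/-- components of the chain map for the shifted complete resolution -/
def stepφ {K : ModuleCat.{u} R} (C : CompleteResolution R K) (P : ModuleCat.{u} R)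
    (e : (res C.P).X 0 ⟶ P) (w : (res C.P).d 1 0 ≫ e = 0) (h : C.T.X (0-1) ⟶ P) :
    ∀ n : ℕ, (shT C.T).X (n : ℤ) ⟶ ((res C.P).augment e w).X n
  | 0 => h
  | n+1 => (C.T.XIsoOfEq (by push_cast; omega : (((n+1 : ℕ) : ℤ) - 1) = n)).hom ≫ C.θ.f n

lemma exists_stepCR {K P M : ModuleCat.{u} R} {f : K →ₗ[R] P} {g : P →ₗ[R] M} (hS : SES f g)
    [Module.Finite R P] [Module.Projective R P] (C : CompleteResolution R K) :
    ∃ C' : CompleteResolution R M, C'.T = shT C.T := by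
  have hP : Projective P := (IsProjective.iff_projective (P : Type u)).1 inferInstance
  let e0 : (res C.P).X 0 ⟶ K := C.π
  have w0 : (res C.P).d 1 0 ≫ e0 = 0 := C.wπ
  have w : (res C.P).d 1 0 ≫ e0 ≫ hS.sc.f = 0 := by rw [← Category.assoc, w0, zero_comp]
  have hepi : Epi e0 := C.epiπ
  obtain ⟨h, hh⟩ := lift_to_proj C.T C.exactTdual P (0-1) 0 1 (by omega) (by omega)
    (C.θ.f 0 ≫ C.π ≫ ModuleCat.ofHom f) (by
      rw [← Category.assoc, ← C.θ.comm, Category.assoc, ← Category.assoc (C.P.d 1 0), C.wπ, zero_comp, comp_zero])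
  have w2 : (e0 ≫ hS.sc.f) ≫ hS.sc.g = 0 := by rw [Category.assoc, hS.sc.zero, comp_zero]
  have hresEx : ∀ n, (res C.P).ExactAt (n+1) := by
    intro n
    have := C.exactP ((n : ℤ) + 1) (by omega)
    rw [HomologicalComplex.exactAt_iff' _ ((n : ℤ)+1+1) ((n:ℤ)+1) n (by simp) (by simp)] at this
    rw [HomologicalComplex.exactAt_iff' _ (n+1+1) (n+1) n (by simp) (by simp)]
    exact this
  obtain ⟨n₀, hn₀⟩ := C.iso_eventually
  refine ⟨mkCR (shT C.T) ((res C.P).augment (e0 ≫ hS.sc.f) w) (stepφ C P _ w h) ?_ hS.sc.g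
    (fun i => C.projT _) (fun i => C.fgT _) ?_ ?_ hS.se.epi_g w2 (aug_exact0 hS.sc hS.se e0 w2) 
    (aug_exactAt hS.sc hS.se _ e0 w0 w C.exact0 hresEx) (fun i => shT_exact _ _ (C.exactT _))
    (fun i => (shT_lyo _ _ _).1 (C.exactTdual _)) (n₀.toNat + 1) ?_, rfl⟩
  · rintro (_|n)
    · show C.T.d _ (0-1) ≫ h = ((C.T.XIsoOfEq _).hom ≫ C.θ.f 0) ≫ (C.π ≫ ModuleCat.ofHom f)
      rw [Category.assoc, ← hh, ← Category.assoc, HomologicalComplex.XIsoOfEq_hom_comp_d]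
    · show C.T.d _ _ ≫ (C.T.XIsoOfEq _).hom ≫ C.θ.f n = ((C.T.XIsoOfEq _).hom ≫ C.θ.f (n+1 : ℕ)) ≫ C.P.d (n+1 : ℕ) n
      rw [Category.assoc, C.θ.comm, ← Category.assoc, ← Category.assoc, HomologicalComplex.XIsoOfEq_hom_comp_d,
        HomologicalComplex.d_comp_XIsoOfEq_hom]
  · rintro (_|n)
    · exact hP
    · exact C.projP _
  · rintro (_|n)
    · exact ‹Module.Finite R P›
    · exact C.fgP _
  · rintro (_|n) hn
    · omega
    · have := hn₀ n (by omega)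
      show IsIso ((C.T.XIsoOfEq _).hom ≫ C.θ.f n)
      infer_instance

/-- Tate vanishing hypothesis -/
def TV (M N : ModuleCat.{u} R) (g : ℕ) : Prop :=
  ∀ (C : CompleteResolution R M) (i : ℤ), (g : ℤ) - 1 ≤ i → IsZero (TateExt R C N i)

lemma TV.step {K M N : ModuleCat.{u} R} {g : ℕ} (h : TV M N (g+1)) (hS : Step K M) : TV K N g := by
  obtain ⟨P, _, _, i, p, hS⟩ := hS
  intro C j hj
  obtain ⟨C', hC'⟩ := exists_stepCR hS C
  have := h C' (j+1) (by push_cast; omega)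
  unfold TateExt at this ⊢
  rw [← HomologicalComplex.exactAt_iff_isZero_homology] at this ⊢
  rw [hC'] at this
  have h2 := (shT_lyo _ _ _).2 this
  rwa [add_sub_cancel_right] at h2

end PartI

section PartJ
set_option linter.unusedSectionVars false
variable {R}
variable [IsNoetherianRing R]

/-- chosen syzygy -/
def syzT (Z : {Z : ModuleCat.{u} R // IsTotallyReflexive R Z}) : {Z : ModuleCat.{u} R // IsTotallyReflexive R Z} :=
  ⟨(exists_syz Z.2).choose, (exists_syz Z.2).choose_spec.1⟩

/-- chosen cosyzygy -/
def cosyzT (Z : {Z : ModuleCat.{u} R // IsTotallyReflexive R Z}) : {Z : ModuleCat.{u} R // IsTotallyReflexive R Z} :=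
  ⟨(exists_cosyz Z.2).choose, (exists_cosyz Z.2).choose_spec.1⟩

lemma syzT_step (Z : {Z : ModuleCat.{u} R // IsTotallyReflexive R Z}) : Step (syzT Z).1 Z.1 :=
  (exists_syz Z.2).choose_spec.2

lemma cosyzT_step (Z : {Z : ModuleCat.{u} R // IsTotallyReflexive R Z}) : Step Z.1 (cosyzT Z).1 :=
  (exists_cosyz Z.2).choose_spec.2

/-- the bi-infinite family of syzygies -/
def zfam (M : {Z : ModuleCat.{u} R // IsTotallyReflexive R Z}) : ℤ → {Z : ModuleCat.{u} R // IsTotallyReflexive R Z}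
  | Int.ofNat n => n.rec M (fun _ Z => syzT Z)
  | Int.negSucc n => n.rec (cosyzT M) (fun _ Z => cosyzT Z)

lemma zfam_step (M : {Z : ModuleCat.{u} R // IsTotallyReflexive R Z}) (i : ℤ) :
    Step (zfam M (i+1)).1 (zfam M i).1 := by
  rcases i with (n|n)
  · exact syzT_step (zfam M (Int.ofNat n))
  · cases n with
    | zero => exact cosyzT_step M
    | succ n => exact cosyzT_step (zfam M (Int.negSucc n))

lemma base_fam {M N : ModuleCat.{u} R} (hM : IsTotallyReflexive R M) (hN : TV M N 0) :
    ∃ Z : ℤ → ModuleCat.{u} R, Z 0 = M ∧ (∀ i, Step (Z (i+1)) (Z i)) ∧ (∀ i, IsTotallyReflexive R (Z i)) ∧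
      ∀ i : ℤ, -2 ≤ i → EV 1 (Z i) N := by
  let Z : ℤ → ModuleCat.{u} R := fun i => (zfam ⟨M, hM⟩ i).1
  have hst : ∀ i, Step (Z (i+1)) (Z i) := zfam_step ⟨M, hM⟩
  have hZ : ∀ i, IsTotallyReflexive R (Z i) := fun i => (zfam ⟨M, hM⟩ i).2
  have hst' := hst
  unfold Step at hst
  choose P hP1 hP2 ι π hS using hst
  have hproj : ∀ i, Projective (P i) := fun i => (IsProjective.iff_projective (P i : Type u)).1 (hP2 i)
  let d : ∀ i, P (i+1) ⟶ P i := fun i => ModuleCat.ofHom (ι i ∘ₗ π (i+1))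
  have hd2 : ∀ i, d (i+1) ≫ d i = 0 := by
    intro i
    ext x
    have : π (i+1) (ι (i+1) (π (i+1+1) x)) = 0 := ((hS (i+1)).ex _).2 ⟨_, rfl⟩
    have : ι i (π (i+1) (ι (i+1) (π (i+1+1) x))) = 0 := by rw [this, map_zero]
    exact this
  let T : ChainComplex (ModuleCat.{u} R) ℤ := ChainComplex.of P d hd2
  have hTd : ∀ i, T.d (i+1) i = d i := fun i => ChainComplex.of_d _ _ _
  have exT1 : ∀ i : ℤ, T.ExactAt (i+1) := by
    intro i
    rw [HomologicalComplex.exactAt_iff' _ (i+1+1) (i+1) i (by simp) (by simp), ShortComplex.moduleCat_exact_iff]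
    intro x hx
    have hx : T.d (i+1) i x = 0 := hx
    rw [hTd] at hx
    have hx : ι i (π (i+1) x) = 0 := hx
    have h1 : π (i+1) x = 0 := (hS i).inj (by rw [hx, map_zero])
    obtain ⟨y, hy⟩ := ((hS (i+1)).ex _).1 h1
    obtain ⟨z, rfl⟩ := (hS (i+1+1)).surj y
    refine ⟨z, ?_⟩
    have : T.d (i+1+1) (i+1) z = x := by rw [hTd]; exact hy
    exact this
  have exTd1 : ∀ (i : ℤ) (N : ModuleCat.{u} R), (T.linearYonedaObj R N).ExactAt (i+1) ↔ EV 1 (Z i) N := by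
    intro i N
    rw [lyo_exactAt_iff T N i (i+1) (i+1+1) rfl rfl, hTd, hTd]
    constructor
    · intro h
      refine (hS i).ev_one (EV.proj _ _) fun φ => ?_
      obtain ⟨ψ, hψ⟩ := h (ModuleCat.ofHom (φ ∘ₗ π (i+1))) (by
        ext x
        have : π (i+1) (ι (i+1) (π (i+1+1) x)) = 0 := ((hS (i+1)).ex _).2 ⟨_, rfl⟩
        have : φ (π (i+1) (ι (i+1) (π (i+1+1) x))) = 0 := by rw [this, map_zero]
        exact this)
      refine ⟨ψ.hom, ?_⟩
      ext z
      obtain ⟨y, rfl⟩ := (hS (i+1)).surj z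
      exact LinearMap.congr_fun (ModuleCat.hom_ext_iff.1 hψ) y
    · intro h f hf
      obtain ⟨φ, hφ⟩ := (hS (i+1)).factor (N := N) f.hom (by
        ext z
        obtain ⟨y, rfl⟩ := (hS (i+1+1)).surj z
        exact LinearMap.congr_fun (ModuleCat.hom_ext_iff.1 hf) y)
      obtain ⟨ψ, hψ⟩ := (hS i).extend h φ
      refine ⟨ModuleCat.ofHom ψ, ?_⟩
      ext x
      have h1 : ψ (ι i (π (i+1) x)) = φ (π (i+1) x) := LinearMap.congr_fun hψ _
      have h2 : φ (π (i+1) x) = f x := LinearMap.congr_fun hφ _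
      exact h1.trans h2
  have exT : ∀ i, T.ExactAt i := fun i => by
    have := exT1 (i-1); rwa [sub_add_cancel] at this
  have exTd : ∀ (i : ℤ) N, (T.linearYonedaObj R N).ExactAt i ↔ EV 1 (Z (i-1)) N := fun i N => by
    have := exTd1 (i-1) N; rwa [sub_add_cancel] at this
  have h10 : T.d 1 0 = d 0 := hTd 0
  let ε : (res T).X 0 ⟶ M := ModuleCat.ofHom (π 0)
  have wε : (res T).d 1 0 ≫ ε = 0 := by
    show T.d 1 0 ≫ ε = 0
    rw [h10]
    ext x
    exact ((hS 0).ex _).2 ⟨_, rfl⟩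
  let C : CompleteResolution R M := mkCR T (res T) (fun n => 𝟙 _) 
    (fun n => (Category.comp_id _).trans (Category.id_comp _).symm) ε hproj hP1
    (fun i => hproj _) (fun i => hP1 _) ((ModuleCat.epi_iff_surjective _).2 (hS 0).surj) wε
    (by
      rw [ShortComplex.moduleCat_exact_iff]
      intro x hx
      obtain ⟨y, hy⟩ := ((hS 0).ex _).1 hx
      obtain ⟨z, rfl⟩ := (hS (0+1)).surj y
      refine ⟨z, ?_⟩
      have : T.d 1 0 z = x := by rw [h10]; exact hy
      exact this)
    (fun n => by
      have := exT ((n : ℤ) + 1)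
      rw [HomologicalComplex.exactAt_iff' _ ((n : ℤ)+1+1) ((n:ℤ)+1) n (by simp) (by simp)] at this
      rw [HomologicalComplex.exactAt_iff' _ (n+1+1) (n+1) n (by simp) (by simp)]
      exact this)
    exT (fun i => (exTd _ _).2 (((tr_iff _).1 (hZ _)).2.2.1 0)) 0 (fun n _ => inferInstanceAs (IsIso (𝟙 _)))
  refine ⟨Z, rfl, hst', hZ, ?_⟩
  intro i hi
  have h := hN C (i+1) (by push_cast; omega)
  unfold TateExt at h
  rw [← HomologicalComplex.exactAt_iff_isZero_homology] at h
  exact (exTd1 i N).1 h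

lemma ev_shift {A B : ModuleCat.{u} R} (h : Step A B) (N : ModuleCat.{u} R) (n : ℕ) (hA : EV (n+1) A N) :
    EV (n+2) B N := by
  obtain ⟨P, _, _, i, p, hS⟩ := h
  exact hS.contraC hA (EV.proj _ _)

lemma base_data {M N : ModuleCat.{u} R} (hM : IsTotallyReflexive R M) (hN : TV M N 0) :
    (∀ n, EV (n+1) M N) ∧ ∃ B₁ B₂, IsTotallyReflexive R B₁ ∧ IsTotallyReflexive R B₂ ∧ 
      Step M B₁ ∧ Step B₁ B₂ ∧ EV 1 B₁ N ∧ EV 1 B₂ N := by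
  obtain ⟨Z, rfl, hst, hZ, hE⟩ := base_fam hM hN
  refine ⟨?_, Z (-1), Z (-2), hZ _, hZ _, (show (-1:ℤ)+1 = 0 from rfl) ▸ hst (-1), (show (-2:ℤ)+1 = -1 from rfl) ▸ hst (-2), hE _ (by omega), hE _ (by omega)⟩
  have : ∀ n : ℕ, ∀ i : ℤ, 0 ≤ i → EV (n+1) (Z i) N := by
    intro n
    induction n with
    | zero => intro i hi; exact hE i (by omega)
    | succ n ih => intro i hi; exact ev_shift (hst i) N n (ih _ (by omega))
  exact fun n => this n 0 le_rfl

end PartJ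

section PartK
set_option linter.unusedSectionVars false
variable {R}
open TensorProduct

lemma dth_nat {A B : ModuleCat.{u} R} (N : ModuleCat.{u} R) (f : A →ₗ[R] B) (x : Module.Dual R B ⊗[R] N) :
    dualTensorHom R A N (f.dualMap.rTensor N x) = dualTensorHom R B N x ∘ₗ f := by
  induction x with
  | zero => simp
  | add x y hx hy => rw [map_add, map_add, map_add, hx, hy]; rfl
  | tmul φ n => ext a; simp

variable [IsNoetherianRing R]

lemma dth_surj {M B N : ModuleCat.{u} R} (hS : Step M B) (hE : EV 1 B N) :
    Function.Surjective (dualTensorHom R M N) := by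
  obtain ⟨P, _, _, i, p, hS⟩ := hS
  intro f
  obtain ⟨h, rfl⟩ := hS.extend hE f
  obtain ⟨y, rfl⟩ := (dualTensorHom_bijective (R := R) (M := P) (N := N)).2 h
  exact ⟨_, dth_nat N i y⟩

lemma dth_inj {M B N : ModuleCat.{u} R} (hS : Step M B) (hB : EV 1 B (RR R))
    (hs : Function.Surjective (dualTensorHom R B N)) : Function.Injective (dualTensorHom R M N) := by
  obtain ⟨P, _, _, i, p, hS⟩ := hS
  have hd := hS.dual hB
  rw [injective_iff_map_eq_zero]
  intro x hx
  obtain ⟨y, rfl⟩ := LinearMap.rTensor_surjective N hd.surj x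
  have h1 := dth_nat N i y
  rw [show (i.dualMap.rTensor N y) = (dm i).rTensor N y from rfl] at h1
  rw [h1] at hx
  obtain ⟨ψ, hψ⟩ := hS.factor _ hx
  obtain ⟨z, rfl⟩ := hs ψ
  have h2 : dualTensorHom R P N (p.dualMap.rTensor N z) = dualTensorHom R P N y := by
    rw [dth_nat, hψ]
  have h3 := (dualTensorHom_bijective (R := R) (M := P) (N := N)).1 h2
  rw [← h3]
  have h4 : (dm i) ∘ₗ (dm p) = 0 := hd.comp0
  have h5 : (dm i).rTensor N ((dm p).rTensor N z) = ((dm i) ∘ₗ (dm p)).rTensor N z := by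
    rw [LinearMap.rTensor_comp]; rfl
  rw [h4, LinearMap.rTensor_zero] at h5
  exact h5

lemma dth_bij {M N : ModuleCat.{u} R} (hM : IsTotallyReflexive R M) (hN : TV M N 0) :
    Function.Bijective (dualTensorHom R M N) := by
  obtain ⟨-, B1, B2, h1, h2, s1, s2, e1, e2⟩ := base_data hM hN
  exact ⟨dth_inj s1 (((tr_iff _).1 h1).2.2.1 0) (dth_surj s2 e2), dth_surj s1 e1⟩

lemma equiv_of_ker {X Y Z : Type u} [AddCommGroup X] [Module R X] [AddCommGroup Y] [Module R Y]
    [AddCommGroup Z] [Module R Z] (a : X →ₗ[R] Y) (b : X →ₗ[R] Z) (ha : Function.Surjective a)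
    (hb : Function.Surjective b) (h : ∀ x, a x = 0 ↔ b x = 0) : Nonempty (Y ≃ₗ[R] Z) := by
  have : LinearMap.ker a = LinearMap.ker b := by ext x; exact h x
  exact ⟨(a.quotKerEquivOfSurjective ha).symm ≪≫ₗ Submodule.quotEquivOfEq _ _ this ≪≫ₗ
    b.quotKerEquivOfSurjective hb⟩

lemma ext_tensor (g : ℕ) : ∀ {M N : ModuleCat.{u} R}, GD g M → TV M N g →
    (∀ i, g < i → EV i M N) ∧ 
    Nonempty (ExtMod R g M N ≃ₗ[R] (ExtMod R g M (RR R) ⊗[R] N)) := by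
  induction g with
  | zero =>
    intro M N hM hN
    refine ⟨?_, ?_⟩
    · rintro (_|n) hi
      · omega
      · exact (base_data hM hN).1 n
    · obtain ⟨e1⟩ := extMod_zero_equiv M N
      obtain ⟨e2⟩ := extMod_zero_equiv M (RR R)
      exact ⟨e1.symm ≪≫ₗ (LinearEquiv.ofBijective _ (dth_bij hM hN)).symm ≪≫ₗ TensorProduct.congr e2 (LinearEquiv.refl R N)⟩
  | succ g ih =>
    rintro M N ⟨K, hK, hst⟩ hN
    have hNK := hN.step hst
    obtain ⟨h1, h2⟩ := ih hK hNK
    refine ⟨?_, ?_⟩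
    · rintro (_|_|i) hi
      · omega
      · omega
      · exact ev_shift hst N i (h1 _ (by omega))
    · obtain ⟨P, _, _, i, p, hS⟩ := hst
      have : Projective hS.sc.X₂ := (IsProjective.iff_projective (P : Type u)).1 inferInstance
      cases g with
      | zero => 
        obtain ⟨φN, hN1, hN2⟩ := extMod_one_pres hS.sc hS.se N
        obtain ⟨φR, hR1, hR2⟩ := extMod_one_pres hS.sc hS.se (RR R)
        have hb := dth_bij hK hNK
        let φR' : Module.Dual R K →ₗ[R] ExtMod R 1 M (RR R) := φR
        have hex : Function.Exact i.dualMap φR' := fun v => hR2 v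
        have hex2 := rTensor_exact N hex hR1
        have hR1' : Function.Surjective (φR'.rTensor N) := LinearMap.rTensor_surjective N hR1
        let φN' : (K →ₗ[R] N) →ₗ[R] ExtMod R 1 M N := φN
        refine equiv_of_ker (X := Module.Dual R K ⊗[R] N) (Y := ExtMod R 1 M N) (Z := ExtMod R 1 M (RR R) ⊗[R] N) (φN' ∘ₗ dualTensorHom R K N) (φR'.rTensor N) (hN1.comp hb.2) hR1' ?_
        intro x
        rw [hex2 x]
        refine (hN2 (dualTensorHom R K N x)).trans ?_
        constructor
        · rintro ⟨y, hy⟩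
          obtain ⟨z, rfl⟩ := (dualTensorHom_bijective (R := R) (M := P) (N := N)).2 y
          refine ⟨z, hb.1 ?_⟩
          rw [dth_nat]; exact hy
        · rintro ⟨z, rfl⟩
          exact ⟨_, (dth_nat N i z).symm⟩
      | succ g =>
        obtain ⟨e1⟩ := extMod_succ_equiv hS.sc hS.se N g
        obtain ⟨e2⟩ := extMod_succ_equiv hS.sc hS.se (RR R) g
        obtain ⟨e3⟩ := h2
        exact ⟨e1 ≪≫ₗ e3 ≪≫ₗ TensorProduct.congr e2.symm (LinearEquiv.refl R N)⟩

end PartK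

section PartL
set_option linter.unusedSectionVars false
variable {R}
open TensorProduct
variable [IsNoetherianRing R]

lemma ext_finite (g : ℕ) : ∀ (M : ModuleCat.{u} R) [Module.Finite R M], Module.Finite R (ExtMod R g M (RR R)) := by
  induction g with
  | zero =>
    intro M _
    obtain ⟨e⟩ := extMod_zero_equiv M (RR R)
    have := fin_du M
    exact Module.Finite.equiv (M := du M) e
  | succ g ih =>
    intro M _
    obtain ⟨K, hKf, P, _, _, i, p, hS⟩ := exists_cover M
    have : Projective hS.sc.X₂ := (IsProjective.iff_projective (P : Type u)).1 inferInstance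
    cases g with
    | zero =>
      obtain ⟨φR, hR1, hR2⟩ := extMod_one_pres hS.sc hS.se (RR R)
      have := fin_du K
      exact Module.Finite.of_surjective (M := du K) φR hR1
    | succ g =>
      obtain ⟨e⟩ := extMod_succ_equiv hS.sc hS.se (RR R) g
      have := ih K
      exact Module.Finite.equiv e.symm

lemma ext_nontrivial {M : ModuleCat.{u} R} [Nontrivial M] {g : ℕ} (hM : GD g M) 
    (hne : ∀ n, g = n + 1 → ¬ EV (n+1) M (RR R)) : Nontrivial (ExtMod R g M (RR R)) := by
  by_contra hc
  rw [not_nontrivial_iff_subsingleton] at hc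
  cases g with
  | zero => 
    obtain ⟨e⟩ := extMod_zero_equiv M (RR R)
    have h1 : Subsingleton (Module.Dual R M) := e.toEquiv.subsingleton
    have h2 : Subsingleton (Module.Dual R (Module.Dual R M)) := inferInstance
    have h3 : Subsingleton M := hM.2.1.1.subsingleton
    exact not_subsingleton M h3
  | succ n =>
    exact hne n rfl ((ev_iff _ _ _).2 (ModuleCat.isZero_of_subsingleton _))

variable [IsLocalRing R]

lemma exists_to_residue (E : Type u) [AddCommGroup E] [Module R E] [Module.Finite R E] [Nontrivial E] :
    ∃ f : E →ₗ[R] IsLocalRing.ResidueField R, Function.Surjective f := by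
  obtain ⟨W, hW⟩ := IsCoatomic.exists_coatom (Submodule R E)
  have hs : IsSimpleModule R (E ⧸ W) := isSimpleModule_iff_isCoatom.2 hW
  obtain ⟨I, hI, ⟨e⟩⟩ := isSimpleModule_iff_quot_maximal.1 hs
  have : I = IsLocalRing.maximalIdeal R := IsLocalRing.eq_maximalIdeal hI
  subst this
  exact ⟨e.toLinearMap ∘ₗ W.mkQ, e.surjective.comp W.mkQ_surjective⟩

lemma tensor_nontrivial (E N : Type u) [AddCommGroup E] [Module R E] [Module.Finite R E] [Nontrivial E]
    [AddCommGroup N] [Module R N] [Module.Finite R N] [Nontrivial N] : Nontrivial (E ⊗[R] N) := by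
  obtain ⟨f, hf⟩ := exists_to_residue (R := R) E
  obtain ⟨h, hh⟩ := exists_to_residue (R := R) N
  have h1 : Function.Surjective (LinearMap.mul' R (IsLocalRing.ResidueField R)) := fun x => ⟨x ⊗ₜ 1, by simp⟩
  have h2 : Function.Surjective (TensorProduct.map f h) := TensorProduct.map_surjective hf hh
  exact (h1.comp h2).nontrivial

lemma sup_eq {M N : ModuleCat.{u} R} [Nontrivial M] [Module.Finite R N] [Nontrivial N] {g : ℕ} 
    (hM : GD g M) (hMf : Module.Finite R M) (hne : ∀ n, g = n + 1 → ¬ EV (n+1) M (RR R)) (hN : TV M N g) :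
    sSup {c : ℕ∞ | ∃ i : ℕ, c = i ∧ ¬ IsZero (ExtMod R i M N)} = g := by
  obtain ⟨h1, ⟨e⟩⟩ := ext_tensor g hM hN
  have h2 := ext_nontrivial hM hne
  have h3 := ext_finite g M
  have h4 : Nontrivial (ExtMod R g M (RR R) ⊗[R] N) := tensor_nontrivial _ _
  have h5 : Nontrivial (ExtMod R g M N) := e.toEquiv.nontrivial
  apply le_antisymm
  · apply sSup_le
    rintro c ⟨i, rfl, hi⟩
    by_contra hlt
    have hlt : g < i := by
      have := not_le.1 hlt
      exact_mod_cast this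
    cases i with
    | zero => omega
    | succ i => exact hi ((ev_iff _ _ _).1 (h1 _ hlt))
  · apply le_sSup
    refine ⟨g, rfl, fun hz => ?_⟩
    exact not_subsingleton _ (ModuleCat.subsingleton_of_isZero hz)

end PartL

section PartM
set_option linter.unusedSectionVars false
variable {R}
open TensorProduct
variable [IsNoetherianRing R] [IsLocalRing R]

variable (R) in
/-- the residue field as an object of `ModuleCat R` -/
abbrev kk : ModuleCat.{u} R := ModuleCat.of R (IsLocalRing.ResidueField R)

instance kk_fin : Module.Finite R (kk R) :=
  Module.Finite.of_surjective (M := R) ((IsLocalRing.maximalIdeal R).mkQ) (Submodule.mkQ_surjective _)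

lemma kk_supp : Module.support R (kk R) = PrimeSpectrum.zeroLocus (IsLocalRing.maximalIdeal R : Set R) := by
  rw [Module.support_eq_zeroLocus]
  congr 2
  exact Ideal.annihilator_quotient (I := IsLocalRing.maximalIdeal R)

lemma smul_lt (M : ModuleCat.{u} R) [Module.Finite R M] [Nontrivial M] :
    IsLocalRing.maximalIdeal R • (⊤ : Submodule R M) < ⊤ := by
  refine lt_top_iff_ne_top.2 (fun h => ?_)
  have := Submodule.eq_bot_of_le_smul_of_le_jacobson_bot (IsLocalRing.maximalIdeal R) (⊤ : Submodule R M)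
    Module.Finite.fg_top h.ge (IsLocalRing.maximalIdeal_le_jacobson _)
  exact top_ne_bot this

lemma depth_eq (M : ModuleCat.{u} R) [Module.Finite R M] [Nontrivial M] (n : ℕ)
    (h1 : ∀ i < n, EV i (kk R) M) (h2 : ¬ EV n (kk R) M) : moduleDepth R M = n := by
  apply le_antisymm
  · apply sSup_le
    rintro c ⟨rs, rfl, hm, hr⟩
    by_contra hlt
    have hlt : n < rs.length := by exact_mod_cast not_le.1 hlt
    exact h2 (ModuleCat.subsingleton_ext_of_exists_isRegular (IsLocalRing.maximalIdeal R) (kk R)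
      kk_supp.subset M (smul_lt M) rs hm hr n hlt)
  · apply le_sSup
    obtain ⟨rs, hl, hm, hr⟩ := ModuleCat.exists_isRegular_of_exists_subsingleton_ext
      (IsLocalRing.maximalIdeal R) n M (smul_lt M) (kk R) kk_supp h1
    exact ⟨rs, by rw [hl], hm, hr⟩

lemma exists_depth : ∃ t : ℕ, (∀ i < t, EV i (kk R) (RR R)) ∧ ¬ EV t (kk R) (RR R) := by
  classical
  have hex : ∃ t : ℕ, ¬ EV t (kk R) (RR R) := by
    by_contra hc
    push Not at hc
    obtain ⟨d, hd⟩ : ∃ d : ℕ, ringKrullDim R ≤ (d : WithBot ℕ∞) := by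
      have h := ringKrullDim_lt_top (R := R)
      obtain ⟨d, hd⟩ := (finiteRingKrullDim_iff_ne_bot_and_top (R := R)).1 inferInstance |> fun _ => 
        (WithBot.ne_bot_iff_exists.1 (ringKrullDim_ne_bot (R := R)))
      rw [← hd] at h ⊢
      have h' : d ≠ ⊤ := by
        rintro rfl
        exact lt_irrefl _ h
      obtain ⟨e, rfl⟩ := ENat.ne_top_iff_exists.1 h'
      exact ⟨e, le_rfl⟩
    obtain ⟨rs, hl, hm, hr⟩ := ModuleCat.exists_isRegular_of_exists_subsingleton_ext
      (IsLocalRing.maximalIdeal R) (d+1) (RR R) (smul_lt (RR R)) (kk R) kk_supp (fun i _ => hc i)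
    have h3 := ringKrullDim_add_length_eq_ringKrullDim_of_isRegular rs hr
    have hnt : Nontrivial (R ⧸ Ideal.ofList rs) := by
      apply Ideal.Quotient.nontrivial_iff.2
      intro h
      exact hr.2 (by simp [h])
    have h4 : (0 : WithBot ℕ∞) ≤ ringKrullDim (R ⧸ Ideal.ofList rs) := ringKrullDim_nonneg_of_nontrivial
    have h5 : ((d+1 : ℕ) : WithBot ℕ∞) ≤ (d : WithBot ℕ∞) := by
      calc ((d+1 : ℕ) : WithBot ℕ∞) = 0 + (rs.length : WithBot ℕ∞) := by rw [hl, zero_add]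
        _ ≤ ringKrullDim (R ⧸ Ideal.ofList rs) + rs.length := by gcongr
        _ ≤ d := by rw [h3]; exact hd
    have : d + 1 ≤ d := by exact_mod_cast h5
    omega
  exact ⟨Nat.find hex, fun i hi => not_not.1 (Nat.find_min hex hi), Nat.find_spec hex⟩

end PartM

section PartN
set_option linter.unusedSectionVars false
variable {R}
open TensorProduct

/-- Push-forward on `Ext`. -/
def pp {X A B : ModuleCat.{u} R} {n : ℕ} (f : A →ₗ[R] B) (α : Abelian.Ext X A n) : Abelian.Ext X B n :=
  α.comp (Abelian.Ext.mk₀ (ModuleCat.ofHom f)) (add_zero n)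

section
variable {X A B C : ModuleCat.{u} R} {n : ℕ}

lemma pp_comp (f : A →ₗ[R] B) (g : B →ₗ[R] C) (α : Abelian.Ext X A n) : pp g (pp f α) = pp (g ∘ₗ f) α := by
  unfold pp
  rw [Abelian.Ext.comp_assoc_of_third_deg_zero, Abelian.Ext.mk₀_comp_mk₀, ← ModuleCat.ofHom_comp]

lemma pp_id (α : Abelian.Ext X A n) : pp LinearMap.id α = α := Abelian.Ext.comp_mk₀_id α

lemma pp_zero (f : A →ₗ[R] B) : pp f (0 : Abelian.Ext X A n) = 0 := by
  unfold pp
  rw [Abelian.Ext.zero_comp]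

lemma pp_zero' (α : Abelian.Ext X A n) : pp (0 : A →ₗ[R] B) α = 0 := by
  unfold pp
  rw [ModuleCat.ofHom_zero, Abelian.Ext.mk₀_zero, Abelian.Ext.comp_zero]

lemma pp_sum {ι : Type} [Fintype ι] (f : A →ₗ[R] B) (α : ι → Abelian.Ext X A n) : 
    pp f (∑ i, α i) = ∑ i, pp f (α i) := by
  unfold pp
  rw [Abelian.Ext.sum_comp]

lemma pp_add' (f g : A →ₗ[R] B) (α : Abelian.Ext X A n) : pp (f + g) α = pp f α + pp g α := by
  unfold pp
  rw [ModuleCat.ofHom_add, Abelian.Ext.mk₀_add, Abelian.Ext.comp_add]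

lemma pp_sum' {ι : Type} (s : Finset ι) (f : ι → (A →ₗ[R] B)) (α : Abelian.Ext X A n) : 
    pp (∑ i ∈ s, f i) α = ∑ i ∈ s, pp (f i) α := by
  classical
  induction s using Finset.induction_on with
  | empty => simpa using pp_zero' α
  | insert a s ha ih => rw [Finset.sum_insert ha, Finset.sum_insert ha, pp_add', ih]

lemma pp_smul' (r : R) (f : A →ₗ[R] B) (α : Abelian.Ext X A n) : pp (r • f) α = r • pp f α := by
  unfold pp
  rw [show ModuleCat.ofHom (r • f) = r • ModuleCat.ofHom f from rfl, Abelian.Ext.mk₀_smul, Abelian.Ext.comp_smul]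

lemma SES.pp_exact {f : A →ₗ[R] B} {g : B →ₗ[R] C} (h : SES f g) (β : Abelian.Ext X B n) (hβ : pp g β = 0) :
    ∃ α : Abelian.Ext X A n, pp f α = β :=
  Abelian.Ext.covariant_sequence_exact₂ X h.se β hβ

lemma SES.drop {f : A →ₗ[R] B} {g : B →ₗ[R] C} (h : SES f g) (α : Abelian.Ext X A n) (hα : pp f α = 0) 
    (hC : ∀ s, n = s + 1 → EV s X C) : α = 0 := by
  cases n with
  | zero =>
    have := h.se.mono_f
    apply Abelian.Ext.postcomp_mk₀_injective_of_mono X h.sc.f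
    rw [map_zero]
    exact hα
  | succ s =>
    obtain ⟨γ, hγ⟩ := Abelian.Ext.covariant_sequence_exact₁ X h.se α hα rfl
    rw [← hγ, (hC s rfl).zero γ, Abelian.Ext.zero_comp]
end

section
variable (X : ModuleCat.{u} R) (n : ℕ)

/-- detection by functionals -/
def PInj (G : ModuleCat.{u} R) : Prop :=
  ∀ α : Abelian.Ext X G n, (∀ φ : G →ₗ[R] (RR R), pp φ α = 0) → α = 0

/-- realizability -/
def PSurj (G : ModuleCat.{u} R) : Prop :=
  ∀ l : (G →ₗ[R] (RR R)) →ₗ[R] Abelian.Ext X (RR R) n, ∃ α : Abelian.Ext X G n, ∀ φ, pp φ α = l φ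

lemma dual_basis (P : ModuleCat.{u} R) [Module.Finite R P] [Module.Projective R P] :
    ∃ (m : ℕ) (p : Fin m → ((RR R) →ₗ[R] P)) (c : Fin m → (P →ₗ[R] (RR R))), 
      ∑ i, p i ∘ₗ c i = LinearMap.id := by
  obtain ⟨m, f, s, _, _, hfs⟩ := Module.Finite.exists_comp_eq_id_of_projective R P
  refine ⟨m, fun i => f ∘ₗ LinearMap.single R (fun _ => R) i, fun i => LinearMap.proj i ∘ₗ s, ?_⟩
  rw [← hfs]
  ext x
  simp only [LinearMap.sum_apply, LinearMap.comp_apply, LinearMap.proj_apply]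
  rw [← map_sum]
  congr 1
  exact Finset.univ_sum_single (s x)

variable {X n}

lemma pinj_proj (P : ModuleCat.{u} R) [Module.Finite R P] [Module.Projective R P] : PInj X n P := by
  obtain ⟨m, p, c, h⟩ := dual_basis P
  intro α hα
  rw [← pp_id α, ← h, pp_sum']
  refine Finset.sum_eq_zero fun i _ => ?_
  rw [← pp_comp, hα, pp_zero]

lemma psurj_proj (P : ModuleCat.{u} R) [Module.Finite R P] [Module.Projective R P] : PSurj X n P := by
  obtain ⟨m, p, c, h⟩ := dual_basis P
  intro l
  refine ⟨∑ i, pp (p i) (l (c i)), fun φ => ?_⟩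
  rw [pp_sum]
  have h1 : ∀ i, pp φ (pp (p i) (l (c i))) = l ((φ (p i (1:R)) : R) • c i) := by
    intro i
    have : φ ∘ₗ p i = (φ (p i (1:R)) : R) • (LinearMap.id : RR R →ₗ[R] RR R) := by
      apply LinearMap.ext_ring
      exact (mul_one (φ (p i (1:R)) : R)).symm
    rw [pp_comp, this, pp_smul', pp_id, map_smul]
  simp_rw [h1]
  rw [← map_sum]
  congr 1
  ext x
  have h2 := LinearMap.congr_fun h x
  rw [LinearMap.sum_apply] at h2
  conv_rhs => rw [show x = (LinearMap.id : P →ₗ[R] P) x from rfl, ← h2, map_sum]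
  rw [LinearMap.sum_apply]
  refine Finset.sum_congr rfl fun i _ => ?_
  have h3 : c i x = (c i x : R) • (1 : R) := (mul_one (c i x : R)).symm
  rw [LinearMap.comp_apply]
  conv_rhs => rw [h3, map_smul, map_smul]
  exact mul_comm (φ (p i (1:R)) : R) (c i x : R)

lemma ev_of_pinj {P : ModuleCat.{u} R} (h : PInj X n P) (hR : EV n X (RR R)) : EV n X P := by
  refine EV.mk fun α => h α fun φ => hR.zero _

variable [IsNoetherianRing R]

lemma tr_ev {t : ℕ} (ht : ∀ i < t, EV i X (RR R)) (i : ℕ) : i < t → 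
    ∀ G, IsTotallyReflexive R G → EV i X G := by
  induction i with
  | zero =>
    intro hi G hG
    obtain ⟨B, hB, P, _, _, f, g, hS⟩ := exists_cosyz hG
    refine EV.mk fun α => hS.drop α ((ev_of_pinj (pinj_proj P) (ht _ hi)).zero _) (by omega)
  | succ i ih =>
    intro hi G hG
    obtain ⟨B, hB, P, _, _, f, g, hS⟩ := exists_cosyz hG
    exact hS.covA (ih (by omega) B hB) (ev_of_pinj (pinj_proj P) (ht _ hi))

lemma tr_pinj {t : ℕ} (ht : ∀ i < t, EV i X (RR R)) (G) (hG : IsTotallyReflexive R G) : PInj X t G := by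
  intro α hα
  obtain ⟨B, hB, P, _, _, f, g, hS⟩ := exists_cosyz hG
  refine hS.drop α (pinj_proj P _ fun φ => ?_) (fun s hs => tr_ev ht s (by omega) B hB)
  rw [pp_comp]
  exact hα _

lemma tr_psurj {t : ℕ} (ht : ∀ i < t, EV i X (RR R)) (G) (hG : IsTotallyReflexive R G) : PSurj X t G := by
  intro l
  obtain ⟨B, hB, P, _, _, f, g, hS⟩ := exists_cosyz hG
  have hd := hS.dual (((tr_iff B).1 hB).2.2.1 0)
  obtain ⟨β, hβ⟩ := psurj_proj P (X := X) (n := t) (l ∘ₗ (LinearMap.lcomp R (RR R) f))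
  have h0 : pp g β = 0 := by
    refine tr_pinj ht B hB _ fun χ => ?_
    rw [pp_comp, hβ, LinearMap.comp_apply]
    have : LinearMap.lcomp R (RR R) f (χ ∘ₗ g) = 0 := by
      ext x
      have := LinearMap.congr_fun hS.comp0 x
      simp only [LinearMap.comp_apply] at this
      simp [this]
    rw [this, map_zero]
  obtain ⟨α, rfl⟩ := hS.pp_exact β h0
  refine ⟨α, fun φ => ?_⟩
  obtain ⟨ψ, rfl⟩ := hd.surj φ
  have := hβ ψ
  rw [pp_comp] at this
  exact this

lemma gd_ev {t : ℕ} (ht : ∀ i < t, EV i X (RR R)) (g : ℕ) : ∀ M, GD g M → ∀ i, i + g < t → EV i X M := by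
  induction g with
  | zero => intro M hM i hi; exact tr_ev ht i hi M hM
  | succ g ih =>
    rintro M ⟨K, hK, P, _, _, f, p, hS⟩ i hi
    exact hS.covC (ev_of_pinj (pinj_proj P) (ht _ (by omega))) (ih K hK _ (by omega))
end

end PartN

section PartO
set_option linter.unusedSectionVars false
variable {R}
open TensorProduct
variable [IsNoetherianRing R] [IsLocalRing R]

lemma exists_to_V {t : ℕ} (ht : ¬ EV t (kk R) (RR R)) (E : Type u) [AddCommGroup E] [Module R E]
    [Module.Finite R E] [Nontrivial E] : ∃ f : E →ₗ[R] Abelian.Ext (kk R) (RR R) t, f ≠ 0 := by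
  obtain ⟨f, hf⟩ := exists_to_residue (R := R) E
  obtain ⟨v, hv⟩ : ∃ v : Abelian.Ext (kk R) (RR R) t, v ≠ 0 := by
    by_contra hc
    push Not at hc
    exact ht (EV.mk hc)
  have hm : ∀ r ∈ IsLocalRing.maximalIdeal R, r • v = 0 := by
    intro r hr
    have h0 : r • (𝟙 (kk R)) = 0 := by
      ext x
      obtain ⟨y, rfl⟩ := Ideal.Quotient.mk_surjective x
      change r • (Ideal.Quotient.mk (IsLocalRing.maximalIdeal R) y) = 0
      rw [← Ideal.Quotient.mk_eq_mk, ← Submodule.Quotient.mk_smul]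
      exact (Submodule.Quotient.mk_eq_zero _).2 (Ideal.mul_mem_right y _ hr)
    rw [← Abelian.Ext.mk₀_id_comp v, ← Abelian.Ext.smul_comp, ← Abelian.Ext.mk₀_smul, h0, Abelian.Ext.mk₀_zero,
      Abelian.Ext.zero_comp]
  let w : IsLocalRing.ResidueField R →ₗ[R] Abelian.Ext (kk R) (RR R) t :=
    (IsLocalRing.maximalIdeal R).liftQ (LinearMap.toSpanSingleton R _ v) (fun r hr => by
      simpa using hm r hr)
  refine ⟨w ∘ₗ f, fun h => hv ?_⟩
  obtain ⟨e, he⟩ := hf (Submodule.Quotient.mk (1:R))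
  have := LinearMap.congr_fun h e
  rw [LinearMap.comp_apply, he] at this
  exact (one_smul R v).symm.trans this

lemma depth_ne {t : ℕ} (ht : ∀ i < t, EV i (kk R) (RR R)) (ht' : ¬ EV t (kk R) (RR R)) (g : ℕ) : 
    ∀ M : ModuleCat.{u} R, Module.Finite R M → GD g M → Nontrivial (ExtMod R g M (RR R)) →
      ∃ s, s + g = t ∧ ¬ EV s (kk R) M := by
  induction g with
  | zero =>
    intro M hMf hM hE
    refine ⟨t, rfl, fun hv => ?_⟩
    obtain ⟨e⟩ := extMod_zero_equiv M (RR R)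
    have := ext_finite 0 M
    obtain ⟨f, hf⟩ := exists_to_V ht' (ExtMod R 0 M (RR R))
    obtain ⟨α, hα⟩ := tr_psurj ht M hM (f ∘ₗ e.toLinearMap)
    apply hf
    ext x
    obtain ⟨y, rfl⟩ := e.surjective x
    have h1 := hα y
    rw [hv.zero α, pp_zero] at h1
    exact h1.symm
  | succ g ih =>
    rintro M hMf ⟨K, hK, P, _, _, i, p, hS⟩ hE
    have : Projective hS.sc.X₂ := (IsProjective.iff_projective (P : Type u)).1 inferInstance
    have hKf : Module.Finite R K := Module.Finite.of_injective i hS.inj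
    have key : ∀ (s' : ℕ) (α : Abelian.Ext (kk R) K s'), α ≠ 0 → pp i α = 0 → s' + g = t → 
        ∃ s, s + (g+1) = t ∧ ¬ EV s (kk R) M := by
      intro s' α hα h0 hs
      by_contra hc
      push Not at hc
      exact hα (hS.drop α h0 fun s hs' => hc s (by omega))
    cases g with
    | zero =>
      obtain ⟨φ, h1, h2⟩ := extMod_one_pres hS.sc hS.se (RR R)
      have := ext_finite 1 M
      obtain ⟨f, hf⟩ := exists_to_V ht' (ExtMod R 1 M (RR R))
      obtain ⟨α, hα⟩ := tr_psurj ht K hK (f ∘ₗ φ)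
      refine key t α ?_ ?_ rfl
      · rintro rfl
        apply hf
        ext x
        obtain ⟨y, rfl⟩ := h1 x
        have h1 := hα y
        rw [pp_zero] at h1
        exact h1.symm
      · refine pinj_proj P _ fun ψ => ?_
        have h3 : φ (ψ ∘ₗ i) = 0 := (h2 _).2 ⟨ψ, rfl⟩
        rw [pp_comp, hα]
        exact (congrArg f h3).trans (map_zero f)
    | succ g =>
      obtain ⟨e⟩ := extMod_succ_equiv hS.sc hS.se (RR R) g
      have hE' : Nontrivial (ExtMod R (g+1) K (RR R)) := e.symm.toEquiv.nontrivial
      obtain ⟨s', hs, hn⟩ := ih K hKf hK hE'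
      obtain ⟨α, hα⟩ : ∃ α : Abelian.Ext (kk R) K s', α ≠ 0 := by
        by_contra hc
        push Not at hc
        exact hn (EV.mk hc)
      exact key s' α hα ((ev_of_pinj (pinj_proj P) (ht _ (by omega))).zero _) hs

lemma auslander_bridger {M : ModuleCat.{u} R} [Module.Finite R M] [Nontrivial M] {g : ℕ} (hM : GD g M) 
    (hne : ∀ n, g = n + 1 → ¬ EV (n+1) M (RR R)) : moduleDepth R R - moduleDepth R M = g := by
  obtain ⟨t, ht, ht'⟩ := exists_depth (R := R)
  obtain ⟨s, hs, hn⟩ := depth_ne ht ht' g M inferInstance hM (ext_nontrivial hM hne)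
  have h1 : moduleDepth R R = t := depth_eq (RR R) t ht ht'
  have h2 : moduleDepth R M = s := depth_eq M s (fun i hi => gd_ev ht g M hM i (by omega)) hn
  rw [h1, h2, ← hs]
  have : ((s + g : ℕ) : ℕ∞) - s = ((s + g - s : ℕ) : ℕ∞) := by norm_cast
  rw [this, Nat.add_sub_cancel_left]

end PartO

/-- Let `M`, `N` be nonzero finitely generated modules over a (Noetherian) local ring `R`
with `G-dim_R M = g < ∞`. If `Êxt^i_R(M,N) = 0` for all `i ≥ g - 1`, then
(i) `sup{ i | Ext^i_R(M,N) ≠ 0 } = depth R - depth_R M`, and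
(ii) `Ext^g_R(M,N) ≅ Ext^g_R(M,R) ⊗_R N`. -/
theorem stmt_10 (R : Type) [CommRing R] [IsNoetherianRing R] [IsLocalRing R]
    (M N : Type) [AddCommGroup M] [Module R M] [Module.Finite R M] [Nontrivial M]
    [AddCommGroup N] [Module R N] [Module.Finite R N] [Nontrivial N]
    (g : ℕ) (hg : gdim R (ModuleCat.of R M) = (g : ℕ∞))
    (hvan : ∀ (C : CompleteResolution R (ModuleCat.of R M)) (i : ℤ),
      (g : ℤ) - 1 ≤ i → IsZero (TateExt R C (ModuleCat.of R N) i)) :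
    (sSup {c : ℕ∞ | ∃ i : ℕ, c = i ∧
        ¬ IsZero (ExtMod R i (ModuleCat.of R M) (ModuleCat.of R N))} =
      moduleDepth R R - moduleDepth R M) ∧
    Nonempty ((ExtMod R g (ModuleCat.of R M) (ModuleCat.of R N)) ≃ₗ[R]
      (TensorProduct R (ExtMod R g (ModuleCat.of R M) (ModuleCat.of R R)) N)) := by
  obtain ⟨hM, hne⟩ := gdim_gd hg
  have : Nontrivial (ModuleCat.of R M) := inferInstanceAs (Nontrivial M)
  have : Nontrivial (ModuleCat.of R N) := inferInstanceAs (Nontrivial N)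
  have : Module.Finite R (ModuleCat.of R M) := inferInstanceAs (Module.Finite R M)
  have : Module.Finite R (ModuleCat.of R N) := inferInstanceAs (Module.Finite R N)
  refine ⟨?_, (ext_tensor g hM hvan).2⟩
  rw [sup_eq hM inferInstance hne hvan]
  exact (auslander_bridger hM hne).symm

end
end
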